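/- arXiv:2310.02073 — 4 statements merged into one kernel-verified Lean document; each statement's English description precedes it below -/
import Mathlib

section
/- Let p be an odd prime and G a finite p-group whose powerful class is less than p (small powerful class). If N is a normal subgroup of G with powerful height less than p, then N is PF-embedded in G: there exists a descending central series N = M_1 ≥ M_2 ≥ ... ≥ M_s = 1 of normal subgroups of G with [M_i, G] ≤ M_{i+1} and [M_i, G, ..., G] (p−1 copies of G) ≤ M_{i+1}^p for all i. -/
/-- The subgroup generated by `p`-th powers of elements of `N`. -/
def pPow {G : Type*} [Group G] (p : ℕ) (N : Subgroup G) : Subgroup G :=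
  Subgroup.closure ((fun x => x ^ p) '' (N : Set G))

theorem pPow_normal {G : Type*} [Group G] (p : ℕ) {N : Subgroup G} (hN : N.Normal) :
    (pPow p N).Normal := by
  constructor
  intro x hx g
  have h : pPow p N ≤ Subgroup.comap (MulAut.conj g).toMonoidHom (pPow p N) := by
    rw [pPow, Subgroup.closure_le]
    rintro - ⟨n, hn, rfl⟩
    have : (MulAut.conj g) (n ^ p) = (g * n * g⁻¹) ^ p := by
      simp [MulAut.conj_apply, conj_pow]
    refine Subgroup.mem_comap.2 ?_
    show (MulAut.conj g) (n ^ p) ∈ _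
    rw [this]
    exact Subgroup.subset_closure ⟨g * n * g⁻¹, hN.conj_mem n hn g, rfl⟩
  simpa using h hx

theorem normal_sSup {G : Type*} [Group G] {S : Set (Subgroup G)}
    (hS : ∀ N ∈ S, N.Normal) : (sSup S).Normal := by
  constructor
  intro x hx g
  have h : sSup S ≤ Subgroup.comap (MulAut.conj g).toMonoidHom (sSup S) := by
    refine sSup_le fun N hN => le_trans ?_ (Subgroup.comap_mono (le_sSup hN))
    intro n hn
    exact Subgroup.mem_comap.2 (by simpa using (hS N hN).conj_mem n hn g)
  simpa using h hx

/-- The upper η-series: `η₀ = 1`, and `η_{i+1}/η_i = η(G/η_i)` is the product of all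
powerfully embedded subgroups of `G/η_i`. -/
def etaUp (p : ℕ) (G : Type*) [Group G] : ℕ → Subgroup G
  | 0 => ⊥
  | i + 1 => sSup {N : Subgroup G | N.Normal ∧ ⁅N, (⊤ : Subgroup G)⁆ ≤ pPow p N ⊔ etaUp p G i}

instance etaUp_normal (p : ℕ) (G : Type*) [Group G] (i : ℕ) : (etaUp p G i).Normal := by
  cases i with
  | zero => show (⊥ : Subgroup G).Normal; infer_instance
  | succ i => exact normal_sSup fun N hN => hN.1

/-- The powerful class of `G`. -/
noncomputable def pwc (p : ℕ) (G : Type*) [Group G] : ℕ := sInf {k | etaUp p G k = ⊤}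

/-- Iterated commutator `[N, G, G, ..., G]` with `i` copies of `G`. -/
def itComm {G : Type*} [Group G] (N : Subgroup G) : ℕ → Subgroup G
  | 0 => N
  | i + 1 => ⁅itComm N i, (⊤ : Subgroup G)⁆

/-- `N` is PF-embedded in `G`: it admits a potent filtration. -/
def PFEmbedded {G : Type*} [Group G] (p : ℕ) (N : Subgroup G) : Prop :=
  ∃ (s : ℕ) (M : ℕ → Subgroup G), M 0 = N ∧ M s = ⊥ ∧
    (∀ i, M (i + 1) ≤ M i) ∧ (∀ i, (M i).Normal) ∧
    (∀ i, ⁅M i, (⊤ : Subgroup G)⁆ ≤ M (i + 1)) ∧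
    (∀ i, itComm (M i) (p - 1) ≤ pPow p (M (i + 1)))

section Power

variable {Q : Type*} [Group Q] {x d z : Q}

theorem pow_mul_of_mul_eq (h : d * x = x * d * z) (hzd : Commute z d) (n : ℕ) :
    d ^ n * x = x * d ^ n * z ^ n := by
  induction n with
  | zero => simp
  | succ n ih =>
    calc d ^ (n + 1) * x = d ^ n * (d * x) := by rw [pow_succ, mul_assoc]
      _ = d ^ n * x * d * z := by rw [h]; simp only [mul_assoc]
      _ = x * d ^ n * (z ^ n * d) * z := by rw [ih]; simp only [mul_assoc]
      _ = x * d ^ (n + 1) * z ^ (n + 1) := by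
        rw [(hzd.pow_left n).eq, pow_succ, pow_succ]; simp only [mul_assoc]

theorem mul_pow_of_mul_eq (h : d * x = x * d * z) (hzx : Commute z x) (hzd : Commute z d) (n : ℕ) :
    (x * d) ^ n = x ^ n * d ^ n * z ^ (n.choose 2) := by
  induction n with
  | zero => simp
  | succ n ih =>
    have hc : (n + 1).choose 2 = n + n.choose 2 := by
      rw [Nat.choose_succ_succ' n 1, Nat.choose_one_right]
    have hcomm : Commute (z ^ n.choose 2) (x * d) := (hzx.mul_right hzd).pow_left _
    calc (x * d) ^ (n + 1) = x ^ n * d ^ n * (z ^ n.choose 2 * (x * d)) := by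
          rw [pow_succ, ih]; simp only [mul_assoc]
      _ = x ^ n * (d ^ n * x) * d * z ^ n.choose 2 := by rw [hcomm.eq]; simp only [mul_assoc]
      _ = x ^ n * x * d ^ n * (z ^ n * d) * z ^ n.choose 2 := by
        rw [pow_mul_of_mul_eq h hzd]; simp only [mul_assoc]
      _ = x ^ (n + 1) * d ^ (n + 1) * z ^ ((n + 1).choose 2) := by
        rw [(hzd.pow_left n).eq, hc, pow_add z, pow_succ, pow_succ]; simp only [mul_assoc]

end Power

section Normal

open scoped commutatorElement

variable {G : Type*} [Group G] {p : ℕ}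

theorem pPow_mono {A B : Subgroup G} (h : A ≤ B) : pPow p A ≤ pPow p B :=
  Subgroup.closure_mono (Set.image_mono h)

theorem pPow_le_self (A : Subgroup G) : pPow p A ≤ A := by
  rw [pPow, Subgroup.closure_le]
  rintro - ⟨a, ha, rfl⟩
  exact A.pow_mem ha p

theorem itComm_normal {N : Subgroup G} (hN : N.Normal) (i : ℕ) : (itComm N i).Normal := by
  induction i with
  | zero => exact hN
  | succ i ih => exact Subgroup.commutator_normal _ _

theorem itComm_mono {A B : Subgroup G} (h : A ≤ B) (i : ℕ) : itComm A i ≤ itComm B i := by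
  induction i with
  | zero => exact h
  | succ i ih => exact Subgroup.commutator_mono ih le_rfl

theorem itComm_add (N : Subgroup G) (i j : ℕ) : itComm (itComm N i) j = itComm N (i + j) := by
  induction j with
  | zero => rfl
  | succ j ih => exact congrArg (fun H => ⁅H, (⊤ : Subgroup G)⁆) ih

theorem itComm_le_self {N : Subgroup G} (hN : N.Normal) (i : ℕ) : itComm N i ≤ N := by
  induction i with
  | zero => exact le_rfl
  | succ i ih =>
    exact (Subgroup.commutator_mono ih le_rfl).trans (Subgroup.commutator_le_left N ⊤)

theorem commutator_top_le_iff {A K : Subgroup G} [K.Normal] :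
    ⁅A, (⊤ : Subgroup G)⁆ ≤ K ↔
      A ≤ (Subgroup.center (G ⧸ K)).comap (QuotientGroup.mk' K) := by
  rw [Subgroup.commutator_le]
  refine forall₂_congr fun a _ => ?_
  rw [Subgroup.mem_comap, Subgroup.mem_center_iff]
  constructor
  · intro h g
    obtain ⟨g, rfl⟩ := QuotientGroup.mk'_surjective K g
    have := (QuotientGroup.eq_one_iff (N := K) _).2 (h g trivial)
    exact (commutatorElement_eq_one_iff_mul_comm.1
      ((map_commutatorElement (QuotientGroup.mk' K) a g).symm.trans this)).symm
  · intro h g _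
    refine (QuotientGroup.eq_one_iff (N := K) _).1 ?_
    exact (map_commutatorElement (QuotientGroup.mk' K) a g).trans
      (commutatorElement_eq_one_iff_mul_comm.2 (h (QuotientGroup.mk' K g)).symm)

theorem commutator_top_sup_le {A B K : Subgroup G} (hK : K.Normal)
    (hA : ⁅A, (⊤ : Subgroup G)⁆ ≤ K) (hB : ⁅B, (⊤ : Subgroup G)⁆ ≤ K) :
    ⁅A ⊔ B, (⊤ : Subgroup G)⁆ ≤ K :=
  commutator_top_le_iff.2 (sup_le (commutator_top_le_iff.1 hA) (commutator_top_le_iff.1 hB))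

theorem itComm_sup_le {A B : Subgroup G} (hA : A.Normal) (hB : B.Normal) (i : ℕ) :
    itComm (A ⊔ B) i ≤ itComm A i ⊔ itComm B i := by
  induction i with
  | zero => exact le_rfl
  | succ i ih =>
    have := itComm_normal hA (i + 1)
    have := itComm_normal hB (i + 1)
    exact (Subgroup.commutator_mono ih le_rfl).trans
      (commutator_top_sup_le (Subgroup.sup_normal _ _) le_sup_left le_sup_right)

theorem commutator_pPow_le (hp : p.Prime) (hodd : Odd p) {N : Subgroup G} (hN : N.Normal) :
    ⁅pPow p N, (⊤ : Subgroup G)⁆ ≤ pPow p ⁅N, (⊤ : Subgroup G)⁆ ⊔ itComm N 3 := by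
  have hN1 : (⁅N, (⊤ : Subgroup G)⁆).Normal := Subgroup.commutator_normal _ _
  have := pPow_normal p hN1
  have := itComm_normal hN 3
  set K := pPow p ⁅N, (⊤ : Subgroup G)⁆ ⊔ itComm N 3 with hK
  have hKn : K.Normal := Subgroup.sup_normal _ _
  have hexp (d : G) (hd : d ∈ ⁅N, (⊤ : Subgroup G)⁆) : (QuotientGroup.mk' K d) ^ p = 1 := by
    rw [← map_pow]
    exact (QuotientGroup.eq_one_iff (N := K) _).2
      ((le_sup_left : _ ≤ K) (Subgroup.subset_closure ⟨d, hd, rfl⟩))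
  have hcen : itComm N 2 ≤ (Subgroup.center (G ⧸ K)).comap (QuotientGroup.mk' K) :=
    commutator_top_le_iff.1 le_sup_right
  rw [commutator_top_le_iff, pPow, Subgroup.closure_le]
  rintro - ⟨x, hx, rfl⟩
  refine Subgroup.mem_comap.2 (Subgroup.mem_center_iff.2 fun g => ?_)
  obtain ⟨y, rfl⟩ := QuotientGroup.mk'_surjective K g
  have hd : ⁅x⁻¹, y⁆ ∈ ⁅N, (⊤ : Subgroup G)⁆ :=
    Subgroup.commutator_mem_commutator (N.inv_mem hx) trivial
  have hz : ⁅⁅x⁻¹, y⁆⁻¹, x⁻¹⁆ ∈ itComm N 2 :=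
    Subgroup.commutator_mem_commutator (Subgroup.inv_mem _ hd) trivial
  have hz1 : ⁅⁅x⁻¹, y⁆⁻¹, x⁻¹⁆ ∈ ⁅N, (⊤ : Subgroup G)⁆ := itComm_le_self hN1 1 hz
  have hzc := Subgroup.mem_center_iff.1 (Subgroup.mem_comap.1 (hcen hz))
  have hmul : QuotientGroup.mk' K ⁅x⁻¹, y⁆ * QuotientGroup.mk' K x =
      QuotientGroup.mk' K x * QuotientGroup.mk' K ⁅x⁻¹, y⁆ *
        QuotientGroup.mk' K ⁅⁅x⁻¹, y⁆⁻¹, x⁻¹⁆ := by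
    simp only [← map_mul]
    congr 1
    simp only [commutatorElement_def]
    group
  have key := mul_pow_of_mul_eq hmul (hzc _).symm (hzc _).symm p
  have hdvd : p ∣ p.choose 2 := by
    refine hp.dvd_choose_self two_ne_zero (lt_of_le_of_ne hp.two_le ?_)
    rintro rfl
    exact absurd hodd (by decide)
  obtain ⟨m, hm⟩ := hdvd
  rw [hexp _ hd, hm, pow_mul, hexp _ hz1, one_pow, mul_one, mul_one, ← map_mul] at key
  have hconj : x * ⁅x⁻¹, y⁆ = y * x * y⁻¹ := by
    simp only [commutatorElement_def]
    group
  rw [hconj, ← map_pow, conj_pow] at key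
  rw [← mul_inv_eq_iff_eq_mul, ← map_inv, ← map_mul, ← map_mul, key, ← map_pow]

theorem le_of_le_sup_commutator [Group.IsNilpotent G] {X Y : Subgroup G} (hY : Y.Normal)
    (hX : X.Normal) (h : X ≤ Y ⊔ ⁅X, (⊤ : Subgroup G)⁆) : X ≤ Y := by
  have hit (n : ℕ) : X ≤ Y ⊔ itComm X n := by
    induction n with
    | zero => exact le_sup_right
    | succ n ih =>
      have := itComm_normal hX (n + 1)
      refine h.trans (sup_le le_sup_left ?_)
      refine (Subgroup.commutator_mono ih le_rfl).trans
        (commutator_top_sup_le (Subgroup.sup_normal _ _) ?_ le_sup_right)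
      exact (Subgroup.commutator_le_left Y ⊤).trans le_sup_left
  have hlcs (n : ℕ) : itComm X n ≤ (⊤ : Subgroup G).lowerCentralSeries n := by
    induction n with
    | zero => exact le_top
    | succ n ih => exact Subgroup.commutator_mono ih le_rfl
  obtain ⟨n, hn⟩ := Subgroup.nilpotent_iff_lowerCentralSeries.1 ‹Group.IsNilpotent G›
  have hbot : itComm X n = ⊥ := le_bot_iff.1 ((hlcs n).trans hn.le)
  simpa [hbot] using hit n

/-- `N` is normal and is the last term of an η-series of length `k`. -/
def HasPowerfulHeight (p : ℕ) : ℕ → Subgroup G → Prop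
  | 0, N => N = ⊥
  | k + 1, N => N.Normal ∧ ∃ B ≤ N, HasPowerfulHeight p k B ∧
      ⁅N, (⊤ : Subgroup G)⁆ ≤ pPow p N ⊔ B

theorem HasPowerfulHeight.normal {k : ℕ} {N : Subgroup G} (h : HasPowerfulHeight p k N) :
    N.Normal := by
  cases k with
  | zero => rw [show N = ⊥ from h]; infer_instance
  | succ k => exact h.1

theorem HasPowerfulHeight.itComm_le {k m : ℕ} {N : Subgroup G} (h : HasPowerfulHeight p k N)
    (hkm : k ≤ m) : itComm N m ≤ pPow p N := by
  induction k generalizing N m with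
  | zero =>
    have hN : N = ⊥ := h
    exact (itComm_le_self h.normal m).trans (hN.le.trans bot_le)
  | succ k ih =>
    obtain ⟨m, rfl⟩ : ∃ j, m = 1 + j := ⟨m - 1, by omega⟩
    obtain ⟨hN, B, hBN, hB, hNB⟩ := h
    have hPn := pPow_normal p hN
    calc itComm N (1 + m) = itComm (itComm N 1) m := (itComm_add N 1 m).symm
      _ ≤ itComm (pPow p N ⊔ B) m := itComm_mono hNB m
      _ ≤ itComm (pPow p N) m ⊔ itComm B m := itComm_sup_le hPn hB.normal m
      _ ≤ pPow p N :=
        sup_le (itComm_le_self hPn m) ((ih hB (by omega)).trans (pPow_mono hBN))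

theorem pPow_sup_powerful [Group.IsNilpotent G] (hp : p.Prime) (hodd : Odd p) {N B : Subgroup G}
    (hN : N.Normal) (hB : B.Normal) (h : ⁅N, (⊤ : Subgroup G)⁆ ≤ pPow p N ⊔ B) :
    ⁅pPow p N ⊔ B, (⊤ : Subgroup G)⁆ ≤ pPow p (pPow p N ⊔ B) ⊔ B := by
  have := pPow_normal p hN
  have hM : (pPow p N ⊔ B).Normal := Subgroup.sup_normal _ _
  have := pPow_normal p hM
  have hY : (pPow p (pPow p N ⊔ B) ⊔ B).Normal := Subgroup.sup_normal _ _
  have hX : (⁅pPow p N ⊔ B, (⊤ : Subgroup G)⁆).Normal := Subgroup.commutator_normal _ _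
  have hX2 : (⁅⁅pPow p N ⊔ B, (⊤ : Subgroup G)⁆, (⊤ : Subgroup G)⁆).Normal :=
    Subgroup.commutator_normal _ _
  refine le_of_le_sup_commutator hY hX
    (commutator_top_sup_le (Subgroup.sup_normal _ _) ?_ ?_)
  · refine (commutator_pPow_le hp hodd hN).trans (sup_le_sup ?_ ?_)
    · exact (pPow_mono h).trans le_sup_left
    · exact itComm_mono h 2
  · exact (Subgroup.commutator_le_left B ⊤).trans (le_sup_right.trans le_sup_left)

theorem itComm_le_pPow_sup [Group.IsNilpotent G] (hp : p.Prime) (hodd : Odd p) {N B : Subgroup G}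
    (hN : N.Normal) {k : ℕ} (hk : k + 1 < p) (hB : HasPowerfulHeight p k B)
    (h : ⁅N, (⊤ : Subgroup G)⁆ ≤ pPow p N ⊔ B) :
    itComm N (p - 1) ≤ pPow p (pPow p N ⊔ B) := by
  obtain ⟨m, hm⟩ : ∃ m, p = m + 3 := by
    refine ⟨p - 3, ?_⟩
    have := hp.two_le
    obtain ⟨j, hj⟩ := hodd
    omega
  have hPn := pPow_normal p hN
  have hBn := hB.normal
  have hN1 : (⁅N, (⊤ : Subgroup G)⁆).Normal := Subgroup.commutator_normal _ _
  have hP1 := pPow_normal p hN1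
  have hM : (pPow p N ⊔ B).Normal := Subgroup.sup_normal _ _
  refine le_of_le_sup_commutator (pPow_normal p hM) (itComm_normal hN _) ?_
  have hpow : itComm (pPow p N) (1 + m) ≤
      pPow p (pPow p N ⊔ B) ⊔ ⁅itComm N (p - 1), (⊤ : Subgroup G)⁆ :=
    calc itComm (pPow p N) (1 + m) = itComm (itComm (pPow p N) 1) m := (itComm_add _ 1 m).symm
      _ ≤ itComm (pPow p ⁅N, (⊤ : Subgroup G)⁆ ⊔ itComm N 3) m :=
        itComm_mono (commutator_pPow_le hp hodd hN) m
      _ ≤ itComm (pPow p ⁅N, (⊤ : Subgroup G)⁆) m ⊔ itComm (itComm N 3) m :=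
        itComm_sup_le hP1 (itComm_normal hN 3) m
      _ ≤ pPow p (pPow p N ⊔ B) ⊔ ⁅itComm N (p - 1), (⊤ : Subgroup G)⁆ := by
        refine sup_le_sup ((itComm_le_self hP1 m).trans (pPow_mono h)) ?_
        rw [itComm_add, show 3 + m = p - 1 + 1 by omega]
        exact le_rfl
  calc itComm N (p - 1) = itComm (itComm N 1) (1 + m) := by
        rw [itComm_add]; congr 1; omega
    _ ≤ itComm (pPow p N ⊔ B) (1 + m) := itComm_mono h _
    _ ≤ itComm (pPow p N) (1 + m) ⊔ itComm B (1 + m) := itComm_sup_le hPn hBn _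
    _ ≤ _ := sup_le hpow
      ((hB.itComm_le (by omega)).trans ((pPow_mono le_sup_right).trans le_sup_left))

theorem pPow_sup_lt [Finite G] (hp : p.Prime) (hG : IsPGroup p G) {N B : Subgroup G}
    (h : B < N) : pPow p N ⊔ B < N := by
  have := Fact.mk hp
  obtain ⟨n, hn⟩ := (IsPGroup.iff_card (p := p)).1 (hG.to_subgroup N)
  obtain ⟨b, hb⟩ := (IsPGroup.iff_card (p := p)).1 (hG.to_subgroup B)
  have hcard : Nat.card (B.subgroupOf N) = p ^ b := by
    rw [← hb]
    exact Nat.card_congr (Subgroup.subgroupOfEquivOfLe h.le).toEquiv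
  have hlt : b < n := by
    rw [← Nat.pow_lt_pow_iff_right hp.one_lt, ← hn, ← hb]
    exact Set.Finite.card_lt_card (Set.toFinite _) h
  obtain ⟨n, rfl⟩ : ∃ j, n = j + 1 := ⟨n - 1, by omega⟩
  obtain ⟨K, hK, hBK⟩ := Sylow.exists_subgroup_card_pow_prime_le p
    (hn ▸ pow_dvd_pow p n.le_succ) (B.subgroupOf N) hcard (Nat.lt_succ_iff.1 hlt)
  have hind : K.index = p := by
    have := K.card_mul_index
    rw [hK, hn, pow_succ] at this
    exact Nat.eq_of_mul_eq_mul_left (pow_pos hp.pos n) this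
  have hKn : K.Normal := Subgroup.normal_of_index_eq_minFac_card (by
    rw [hind, hn, hp.pow_minFac n.succ_ne_zero])
  have hle : pPow p N ⊔ B ≤ K.map N.subtype := by
    refine sup_le ?_ fun y hy => ⟨⟨y, h.le hy⟩, hBK (Subgroup.mem_subgroupOf.2 hy), rfl⟩
    rw [pPow, Subgroup.closure_le]
    rintro - ⟨y, hy, rfl⟩
    refine ⟨⟨y, hy⟩ ^ p, ?_, rfl⟩
    simpa [hind] using K.pow_index_mem ⟨y, hy⟩
  refine lt_of_le_of_ne (sup_le (pPow_le_self N) h.le) fun heq => ?_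
  have htop : K = ⊤ := by
    refine (Subgroup.eq_top_iff' K).2 fun y => ?_
    obtain ⟨y', hy', hyy⟩ := hle (heq.ge y.2)
    exact Subtype.ext hyy ▸ hy'
  rw [htop, Subgroup.index_top] at hind
  exact hp.one_lt.ne hind

theorem PFEmbedded.cons {N M : Subgroup G} (hM : PFEmbedded p M) (hN : N.Normal) (hMN : M ≤ N)
    (hcen : ⁅N, (⊤ : Subgroup G)⁆ ≤ M) (hpot : itComm N (p - 1) ≤ pPow p M) :
    PFEmbedded p N := by
  obtain ⟨s, F, hF0, hFs, hFmono, hFn, hFc, hFp⟩ := hM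
  subst hF0
  refine ⟨s + 1, fun i => Nat.casesOn i N F, rfl, hFs, ?_, ?_, ?_, ?_⟩
  · rintro (_ | i)
    exacts [hMN, hFmono i]
  · rintro (_ | i)
    exacts [hN, hFn i]
  · rintro (_ | i)
    exacts [hcen, hFc i]
  · rintro (_ | i)
    exacts [hpot, hFp i]

theorem HasPowerfulHeight.pfEmbedded [Finite G] (hp : p.Prime) (hodd : Odd p) (hG : IsPGroup p G)
    {k : ℕ} (hk : k < p) {N : Subgroup G} (h : HasPowerfulHeight p k N) : PFEmbedded p N := by
  have := Fact.mk hp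
  have : Group.IsNilpotent G := hG.isNilpotent
  induction k generalizing N with
  | zero =>
    have hN : N = ⊥ := h
    refine ⟨0, fun _ => ⊥, hN.symm, rfl, fun _ => le_rfl, fun _ => inferInstance,
      fun _ => Subgroup.commutator_le_left _ _, fun _ => ?_⟩
    exact (itComm_le_self inferInstance _).trans bot_le
  | succ k ih =>
    obtain ⟨hN, B, hBN, hB, hNB⟩ := h
    have hBn := hB.normal
    induction hc : Nat.card N using Nat.strong_induction_on generalizing N with
    | _ c ihc =>
      obtain rfl | hlt := hBN.eq_or_lt
      · exact ih (by omega) hB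
      · have hM := pPow_sup_lt hp hG hlt
        have := pPow_normal p hN
        refine PFEmbedded.cons (M := pPow p N ⊔ B) ?_ hN hM.le hNB
          (itComm_le_pPow_sup hp hodd hN hk hB hNB)
        exact ihc _ (hc ▸ Set.Finite.card_lt_card (Set.toFinite _) hM)
          (Subgroup.sup_normal _ _) le_sup_right
          (pPow_sup_powerful hp hodd hN hBn hNB) rfl

end Normal

/-- in a finite `p`-group of small powerful class, every normal subgroup of
small powerful height is PF-embedded. -/
theorem small_powerful_height_PFEmbedded {p : ℕ} (hp : p.Prime) (hodd : Odd p)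
    {G : Type*} [Group G] [Finite G] (hG : IsPGroup p G) (hsmall : pwc p G < p)
    {N : Subgroup G} (hN : N.Normal) {k : ℕ} (hk : k < p)
    (C : ℕ → Subgroup G) (hC0 : C 0 = ⊥) (hCk : C k = N)
    (hmono : ∀ i, C i ≤ C (i + 1)) (hnorm : ∀ i, (C i).Normal)
    (hpe : ∀ i < k, ⁅C (i + 1), (⊤ : Subgroup G)⁆ ≤ pPow p (C (i + 1)) ⊔ C i) :
    PFEmbedded p N := by
  have hC (i : ℕ) (hi : i ≤ k) : HasPowerfulHeight p i (C i) := by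
    induction i with
    | zero => exact hC0
    | succ i ih => exact ⟨hnorm _, C i, hmono i, ih (by omega), hpe i (by omega)⟩
  exact hCk ▸ (hC k le_rfl).pfEmbedded hp hodd hG hk
end

section
/- Let p be an odd prime and G a finite p-group of powerful class k with k ≤ ℓ(p−1). Then Ω_i(G)^{p^{i+ℓ}} = 1, i.e., the subgroup generated by elements of order dividing p^i has exponent dividing p^{i+ℓ}. -/
namespace OmegaBound

open Subgroup
open scoped commutatorElement

universe u

section Commutators

variable {G : Type*} [Group G]

theorem commutator_le_iff_le_comap {A C T : Subgroup G} [T.Normal] :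
    ⁅A, C⁆ ≤ T ↔
      A ≤ (centralizer (C.map (QuotientGroup.mk' T) : Set (G ⧸ T))).comap
        (QuotientGroup.mk' T) := by
  rw [← map_le_iff_le_comap, ← commutator_eq_bot_iff_le_centralizer, ← map_commutator,
    Subgroup.map_eq_bot_iff, QuotientGroup.ker_mk']

theorem commutator_sup_le {A B C T : Subgroup G} [T.Normal] (hA : ⁅A, C⁆ ≤ T)
    (hB : ⁅B, C⁆ ≤ T) : ⁅A ⊔ B, C⁆ ≤ T := by
  rw [commutator_le_iff_le_comap] at *
  exact sup_le hA hB

theorem commutator_sSup_le {S : Set (Subgroup G)} {C T : Subgroup G} [T.Normal]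
    (h : ∀ A ∈ S, ⁅A, C⁆ ≤ T) : ⁅sSup S, C⁆ ≤ T := by
  rw [commutator_le_iff_le_comap]
  exact sSup_le fun A hA => commutator_le_iff_le_comap.1 (h A hA)

theorem commutatorElement_mem_iff {T : Subgroup G} [T.Normal] {x y : G} :
    ⁅x, y⁆ ∈ T ↔ Commute (x : G ⧸ T) (y : G ⧸ T) := by
  rw [← commutatorElement_eq_one_iff_commute, ← QuotientGroup.eq_one_iff]
  rfl

theorem commutator_closure_left_le {S : Set G} {C T : Subgroup G} [T.Normal]
    (h : ∀ x ∈ S, ∀ y ∈ C, ⁅x, y⁆ ∈ T) : ⁅closure S, C⁆ ≤ T := by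
  rw [commutator_le_iff_le_comap, closure_le]
  rintro x hx - ⟨y, hy, rfl⟩
  exact (commutatorElement_mem_iff.1 (h x hx y hy)).symm

theorem commutator_closure_right_le {S : Set G} {C T : Subgroup G} [T.Normal]
    (h : ∀ x ∈ C, ∀ y ∈ S, ⁅x, y⁆ ∈ T) : ⁅C, closure S⁆ ≤ T := by
  rw [commutator_comm]
  refine commutator_closure_left_le fun y hy x hx => ?_
  rw [← commutatorElement_inv]
  exact inv_mem (h x hx y hy)

/-- The three subgroups lemma modulo a normal subgroup. -/
theorem commutator_commutator_le_of_rotate {A B C T : Subgroup G} [T.Normal]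
    (h1 : ⁅⁅B, C⁆, A⁆ ≤ T) (h2 : ⁅⁅C, A⁆, B⁆ ≤ T) : ⁅⁅A, B⁆, C⁆ ≤ T := by
  rw [← QuotientGroup.ker_mk' T, ← Subgroup.map_eq_bot_iff, map_commutator,
    map_commutator] at *
  exact commutator_commutator_eq_bot_of_rotate h1 h2

theorem mul_pow_of_commute_commutator {x y q : G} (h : y * x = x * y * q) (hx : Commute q x)
    (hy : Commute q y) (n : ℕ) : (x * y) ^ n = x ^ n * y ^ n * q ^ n.choose 2 := by
  have aux : ∀ n : ℕ, y ^ n * x = x * y ^ n * q ^ n := by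
    intro n
    induction n with
    | zero => simp
    | succ n ih =>
      calc y ^ (n + 1) * x = y ^ n * (y * x) := by rw [pow_succ, mul_assoc]
        _ = (y ^ n * x) * (y * q) := by rw [h]; group
        _ = x * y ^ n * (q ^ n * y) * q := by rw [ih]; group
        _ = x * y ^ (n + 1) * q ^ (n + 1) := by rw [(hy.pow_left n).eq]; group
  induction n with
  | zero => simp
  | succ n ih =>
    have hc : (n + 1).choose 2 = n + n.choose 2 := by
      rw [Nat.choose_succ_succ' n 1, Nat.choose_one_right]
    calc (x * y) ^ (n + 1) = x ^ n * y ^ n * (q ^ n.choose 2 * (x * y)) := by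
          rw [pow_succ, ih]; group
      _ = x ^ n * (y ^ n * x) * y * q ^ n.choose 2 := by
          rw [((hx.mul_right hy).pow_left _).eq]; group
      _ = x ^ n * x * y ^ n * (q ^ n * y) * q ^ n.choose 2 := by rw [aux]; group
      _ = x ^ (n + 1) * y ^ (n + 1) * q ^ (n + 1).choose 2 := by
          rw [(hy.pow_left n).eq, hc, pow_add]; group

theorem mul_pow_prime_of_commute_commutator {p : ℕ} (hp : p.Prime) (hodd : Odd p) {x y q : G}
    (h : y * x = x * y * q) (hx : Commute q x) (hy : Commute q y) (hq : q ^ p = 1) :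
    (x * y) ^ p = x ^ p * y ^ p := by
  have h2 : 2 < p := hp.two_le.lt_of_ne (by rintro rfl; exact absurd hodd (by decide))
  obtain ⟨m, hm⟩ := hp.dvd_choose_self (k := 2) (by norm_num) h2
  rw [mul_pow_of_commute_commutator h hx hy, hm, pow_mul, hq, one_pow, mul_one]

theorem itComm_le_lowerCentralSeries (D : Subgroup G) (n : ℕ) :
    itComm D n ≤ (⊤ : Subgroup G).lowerCentralSeries n := by
  induction n with
  | zero => exact le_top
  | succ n ih => exact commutator_mono ih le_rfl

/-- In a nilpotent group a bound on `⁅D, ⊤⁆` modulo `⁅⁅D, ⊤⁆, ⊤⁆` holds absolutely. -/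
theorem commutator_top_le_of_le_sup [Group.IsNilpotent G] {D R : Subgroup G} [D.Normal]
    [R.Normal] (h : ⁅D, (⊤ : Subgroup G)⁆ ≤ R ⊔ ⁅⁅D, (⊤ : Subgroup G)⁆, (⊤ : Subgroup G)⁆) :
    ⁅D, (⊤ : Subgroup G)⁆ ≤ R := by
  have hnorm : ∀ n, (itComm D n).Normal := by
    intro n
    induction n with
    | zero => assumption
    | succ n ih => exact commutator_normal _ _
  have key : ∀ n, ⁅D, (⊤ : Subgroup G)⁆ ≤ R ⊔ itComm D (n + 1) := by
    intro n
    induction n with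
    | zero => exact le_sup_right
    | succ n ih =>
      have := hnorm (n + 2)
      refine h.trans (sup_le le_sup_left ((commutator_mono ih le_rfl).trans ?_))
      exact commutator_sup_le ((commutator_le_left _ _).trans le_sup_left) le_sup_right
  obtain ⟨n, hn⟩ := Subgroup.nilpotent_iff_lowerCentralSeries.1 ‹Group.IsNilpotent G›
  refine (key n).trans (sup_le le_rfl ?_)
  refine (itComm_le_lowerCentralSeries D (n + 1)).trans ?_
  exact ((Subgroup.lowerCentralSeries_antitone _ (Nat.le_succ n)).trans hn.le).trans bot_le

end Commutators

section Powers

variable {G : Type*} [Group G] {p : ℕ}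

theorem pow_mem_pPow {N : Subgroup G} {x : G} (hx : x ∈ N) : x ^ p ∈ pPow p N :=
  subset_closure ⟨x, hx, rfl⟩

theorem pPow_le_iff {N M : Subgroup G} : pPow p N ≤ M ↔ ∀ x ∈ N, x ^ p ∈ M := by
  rw [pPow, closure_le]
  exact Set.image_subset_iff

theorem pPow_le (N : Subgroup G) : pPow p N ≤ N :=
  pPow_le_iff.2 fun _ hx => pow_mem hx p

theorem pPow_mono {N M : Subgroup G} (h : N ≤ M) : pPow p N ≤ pPow p M :=
  pPow_le_iff.2 fun _ hx => pow_mem_pPow (h hx)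

theorem map_pPow {H : Type*} [Group H] (f : G →* H) (N : Subgroup G) :
    (pPow p N).map f = pPow p (N.map f) := by
  rw [pPow, MonoidHom.map_closure, pPow]
  congr 1
  ext y
  simp

theorem commutator_pPow_le (hp : p.Prime) (hodd : Odd p) (N : Subgroup G) [N.Normal] :
    ⁅pPow p N, (⊤ : Subgroup G)⁆ ≤ pPow p ⁅N, (⊤ : Subgroup G)⁆ ⊔
      ⁅⁅⁅N, (⊤ : Subgroup G)⁆, (⊤ : Subgroup G)⁆, (⊤ : Subgroup G)⁆ := by
  set M := ⁅N, (⊤ : Subgroup G)⁆ with hM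
  set R := pPow p M ⊔ ⁅⁅M, (⊤ : Subgroup G)⁆, (⊤ : Subgroup G)⁆ with hR
  have : (pPow p M).Normal := pPow_normal p inferInstance
  have : R.Normal := sup_normal _ _
  refine commutator_closure_left_le ?_
  rintro - ⟨n, hn, rfl⟩ g -
  rw [commutatorElement_mem_iff]
  have hc : ⁅n⁻¹, g⁆ ∈ M := commutator_mem_commutator (inv_mem hn) (mem_top g)
  have hq : ⁅⁅n⁻¹, g⁆⁻¹, n⁻¹⁆ ∈ ⁅M, (⊤ : Subgroup G)⁆ :=
    commutator_mem_commutator (inv_mem hc) (mem_top _)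
  have hqM : ⁅⁅n⁻¹, g⁆⁻¹, n⁻¹⁆ ∈ M := commutator_le_left _ _ hq
  have hcomm : ∀ z : G, Commute ((⁅⁅n⁻¹, g⁆⁻¹, n⁻¹⁆ : G) : G ⧸ R) (z : G ⧸ R) := fun z =>
    commutatorElement_mem_iff.1 (le_sup_right (a := pPow p M)
      (commutator_mem_commutator hq (mem_top z)))
  have hpow : ∀ z ∈ M, ((z : G) : G ⧸ R) ^ p = 1 := fun z hz => by
    rw [← QuotientGroup.mk_pow, QuotientGroup.eq_one_iff]
    exact le_sup_left (a := pPow p M) (pow_mem_pPow hz)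
  have key := mul_pow_prime_of_commute_commutator hp hodd
    (x := (n : G ⧸ R)) (y := ((⁅n⁻¹, g⁆ : G) : G ⧸ R)) (q := ((⁅⁅n⁻¹, g⁆⁻¹, n⁻¹⁆ : G) : G ⧸ R))
    (by simp only [← QuotientGroup.mk_mul]
        congr 1; simp only [commutatorElement_def]; group)
    (hcomm _) (hcomm _) (hpow _ hqM)
  rw [hpow _ hc, mul_one] at key
  have e : (n : G ⧸ R) * ((⁅n⁻¹, g⁆ : G) : G ⧸ R) = (g : G ⧸ R) * n * (g : G ⧸ R)⁻¹ := by
    simp only [← QuotientGroup.mk_mul, ← QuotientGroup.mk_inv]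
    congr 1; simp only [commutatorElement_def]; group
  rw [e, conj_pow] at key
  show ((n ^ p : G) : G ⧸ R) * g = g * ((n ^ p : G) : G ⧸ R)
  rw [QuotientGroup.mk_pow]
  exact (mul_inv_eq_iff_eq_mul.1 key).symm

theorem commutator_pPow_top_le [Group.IsNilpotent G] (hp : p.Prime) (hodd : Odd p)
    {N : Subgroup G} [N.Normal] (h : ⁅N, (⊤ : Subgroup G)⁆ ≤ pPow p N) :
    ⁅pPow p N, (⊤ : Subgroup G)⁆ ≤ pPow p (pPow p N) := by
  have h1 : (pPow p N).Normal := pPow_normal p inferInstance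
  have h2 : (pPow p (pPow p N)).Normal := pPow_normal p inferInstance
  refine commutator_top_le_of_le_sup ((commutator_pPow_le hp hodd N).trans ?_)
  exact sup_le_sup (pPow_mono h) (commutator_mono (commutator_mono h le_rfl) le_rfl)

/-- Iterated `p`-th power subgroups. -/
def iterPow (p : ℕ) (N : Subgroup G) : ℕ → Subgroup G
  | 0 => N
  | a + 1 => pPow p (iterPow p N a)

theorem iterPow_normal {N : Subgroup G} (hN : N.Normal) (a : ℕ) : (iterPow p N a).Normal := by
  induction a with
  | zero => exact hN
  | succ a ih => exact pPow_normal p ih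

theorem iterPow_antitone (N : Subgroup G) : Antitone (iterPow p N) :=
  antitone_nat_of_succ_le fun _ => pPow_le _

theorem map_iterPow {H : Type*} [Group H] (f : G →* H) (N : Subgroup G) (a : ℕ) :
    (iterPow p N a).map f = iterPow p (N.map f) a := by
  induction a with
  | zero => rfl
  | succ a ih => rw [iterPow, map_pPow, ih, iterPow]

theorem iterPow_mono {N M : Subgroup G} (h : N ≤ M) (a : ℕ) : iterPow p N a ≤ iterPow p M a := by
  induction a with
  | zero => exact h
  | succ a ih => exact pPow_mono ih

theorem commutator_iterPow_le [Group.IsNilpotent G] (hp : p.Prime) (hodd : Odd p)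
    {N : Subgroup G} [hN : N.Normal] (h : ⁅N, (⊤ : Subgroup G)⁆ ≤ pPow p N) (a : ℕ) :
    ⁅iterPow p N a, (⊤ : Subgroup G)⁆ ≤ iterPow p N (a + 1) := by
  induction a with
  | zero => exact h
  | succ a ih =>
    have := iterPow_normal (p := p) hN a
    exact commutator_pPow_top_le hp hodd ih

end Powers

section Powerful

/-- A group whose commutators lie in the subgroup generated by `p`-th powers. -/
def Powerful (p : ℕ) (K : Type*) [Group K] : Prop :=
  ⁅(⊤ : Subgroup K), (⊤ : Subgroup K)⁆ ≤ pPow p ⊤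

variable {p : ℕ}

theorem Powerful.of_surjective {K L : Type*} [Group K] [Group L] (h : Powerful p K) (f : K →* L)
    (hf : Function.Surjective f) : Powerful p L := by
  have := Subgroup.map_mono (f := f) h
  rwa [map_commutator, map_pPow, map_top_of_surjective f hf] at this

theorem Powerful.quotient {K : Type*} [Group K] (h : Powerful p K) (N : Subgroup K) [N.Normal] :
    Powerful p (K ⧸ N) :=
  h.of_surjective (QuotientGroup.mk' N) (QuotientGroup.mk'_surjective N)

variable {G : Type*} [Group G]

theorem powerful_subtype_iff {S : Subgroup G} : Powerful p S ↔ ⁅S, S⁆ ≤ pPow p S := by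
  rw [Powerful, ← map_le_map_iff_of_injective S.subtype_injective, map_commutator, map_pPow,
    ← MonoidHom.range_eq_map, range_subtype]

theorem powerful_zpowers_sup {N : Subgroup G} (hN : N.Normal)
    (h : ⁅N, (⊤ : Subgroup G)⁆ ≤ pPow p N) (x : G) :
    Powerful p (zpowers x ⊔ N : Subgroup G) := by
  rw [powerful_subtype_iff]
  have hT : (pPow p N).Normal := pPow_normal p hN
  have h' : ∀ C : Subgroup G, ⁅N, C⁆ ≤ pPow p N := fun C => (commutator_mono le_rfl le_top).trans h
  refine le_trans (commutator_sup_le ?_ (h' _)) (pPow_mono (le_sup_right (a := zpowers x)))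
  rw [commutator_comm]
  refine commutator_sup_le ?_ (h' _)
  rw [commutator_self_eq_bot_iff.2 inferInstance]
  exact bot_le

theorem sup_pPow_ne_top [Finite G] (hp : p.Prime) (hG : IsPGroup p G) {M : Subgroup G}
    (hM : M ≠ ⊤) : M ⊔ pPow p ⊤ ≠ ⊤ := by
  have := Fact.mk hp
  have := hG.isNilpotent
  obtain h | ⟨C, hC, hMC⟩ := IsCoatomic.eq_top_or_exists_le_coatom M
  · exact absurd h hM
  have hCn : C.Normal := NormalizerCondition.normal_of_coatom C
    Group.normalizerCondition_of_isNilpotent hC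
  intro htop
  refine hC.1 (top_le_iff.1 (htop ▸ sup_le hMC (pPow_le_iff.2 fun g _ => ?_)))
  obtain ⟨n, hn⟩ := IsPGroup.iff_card.1 (hG.to_subgroup C)
  obtain ⟨m, hm⟩ := IsPGroup.iff_card.1 hG
  have hnm : n + 1 ≤ m := by
    by_contra! hlt
    refine hC.1 (eq_top_of_le_card C ?_)
    rw [hn, hm]
    exact Nat.pow_le_pow_right hp.pos (by omega)
  obtain ⟨D, hD, hCD⟩ := Sylow.exists_subgroup_card_pow_succ (hm ▸ pow_dvd_pow p hnm) hn
  have hDtop : D = ⊤ := hC.2 D (lt_of_le_of_ne hCD (by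
    rintro rfl
    rw [hn] at hD
    exact absurd (Nat.pow_right_injective hp.two_le hD) (by omega)))
  have hidx : C.index = p := by
    have h1 := C.card_mul_index
    rw [hDtop, Subgroup.card_top] at hD
    rw [hn, hD, pow_succ] at h1
    exact Nat.eq_of_mul_eq_mul_left (pow_pos hp.pos n) h1
  exact hidx ▸ C.pow_index_mem g

theorem exists_pow_eq_of_mem_pPow_top (h : ∀ x y : G, (x * y) ^ p = x ^ p * y ^ p) {g : G}
    (hg : g ∈ pPow p (⊤ : Subgroup G)) : ∃ x, x ^ p = g := by
  refine closure_induction ?_ ⟨1, one_pow p⟩ ?_ ?_ hg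
  · rintro - ⟨x, -, rfl⟩
    exact ⟨x, rfl⟩
  · rintro - - - - ⟨x, rfl⟩ ⟨y, rfl⟩
    exact ⟨x * y, h x y⟩
  · rintro - - ⟨x, rfl⟩
    exact ⟨x⁻¹, inv_pow x p⟩

theorem exists_pow_eq_of_mem_pPow_subtype {S : Subgroup G} {g : G} (hg : g ∈ pPow p S)
    (h : ∀ u ∈ pPow p (⊤ : Subgroup S), ∃ z, z ^ p = u) : ∃ z ∈ S, z ^ p = g := by
  have e : (pPow p (⊤ : Subgroup S)).map S.subtype = pPow p S := by
    rw [map_pPow, ← MonoidHom.range_eq_map, range_subtype]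
  rw [← e] at hg
  obtain ⟨u, hu, rfl⟩ := hg
  obtain ⟨z, rfl⟩ := h u hu
  exact ⟨z, z.2, rfl⟩

theorem card_lt_of_ne_top [Finite G] {S : Subgroup G} (h : S ≠ ⊤) : Nat.card S < Nat.card G := by
  by_contra! hle
  exact h (eq_top_of_le_card S hle)

theorem card_quotient_lt_of_ne_bot [Finite G] {N : Subgroup G} (h : N ≠ ⊥) :
    Nat.card (G ⧸ N) < Nat.card G := by
  rw [N.card_eq_card_quotient_mul_card_subgroup]
  have h1 : 0 < Nat.card (G ⧸ N) := Nat.card_pos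
  have h2 : 1 < Nat.card N := N.one_lt_card_iff_ne_bot.2 h
  exact lt_mul_of_one_lt_right h1 h2

theorem commute_of_zpowers_eq_top {x : G} (h : zpowers x = ⊤) (a b : G) : Commute a b := by
  obtain ⟨m, rfl⟩ := mem_zpowers_iff.1 (h ▸ mem_top a)
  obtain ⟨n, rfl⟩ := mem_zpowers_iff.1 (h ▸ mem_top b)
  exact Commute.zpow_zpow_self x m n

theorem mk_pow_eq_of_powerful (hp : p.Prime) (hodd : Odd p) [Group.IsNilpotent G]
    (h : Powerful p G) (R : Subgroup G) [R.Normal] (hR : pPow p (pPow p ⊤) ≤ R) (x y : G ⧸ R) :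
    (x * y) ^ p = x ^ p * y ^ p := by
  obtain ⟨x, rfl⟩ := QuotientGroup.mk_surjective x
  obtain ⟨y, rfl⟩ := QuotientGroup.mk_surjective y
  have hc : ⁅y⁻¹, x⁻¹⁆ ∈ pPow p (⊤ : Subgroup G) :=
    h (commutator_mem_commutator (mem_top _) (mem_top _))
  have hcomm : ∀ z : G, Commute ((⁅y⁻¹, x⁻¹⁆ : G) : G ⧸ R) (z : G ⧸ R) := fun z =>
    commutatorElement_mem_iff.1 (hR (commutator_pPow_top_le hp hodd h
      (commutator_mem_commutator hc (mem_top z))))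
  refine mul_pow_prime_of_commute_commutator hp hodd (q := ((⁅y⁻¹, x⁻¹⁆ : G) : G ⧸ R)) ?_
    (hcomm _) (hcomm _) ?_
  · simp only [← QuotientGroup.mk_mul]
    congr 1; simp only [commutatorElement_def]; group
  · rw [← QuotientGroup.mk_pow, QuotientGroup.eq_one_iff]
    exact hR (pow_mem_pPow hc)

theorem Powerful.exists_pow_eq [Finite G] (hp : p.Prime) (hodd : Odd p) (hG : IsPGroup p G)
    (h : Powerful p G) {g : G} (hg : g ∈ pPow p (⊤ : Subgroup G)) : ∃ x, x ^ p = g := by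
  induction hn : Nat.card G using Nat.strong_induction_on generalizing G with
  | _ n ih =>
  have := Fact.mk hp
  have := hG.isNilpotent
  have hn1 : (pPow p (⊤ : Subgroup G)).Normal := pPow_normal p inferInstance
  have hn2 : (pPow p (pPow p (⊤ : Subgroup G))).Normal := pPow_normal p hn1
  have hq : (g : G ⧸ pPow p (pPow p (⊤ : Subgroup G))) ∈
      pPow p (⊤ : Subgroup (G ⧸ pPow p (pPow p (⊤ : Subgroup G)))) := by
    rw [← map_top_of_surjective _ (QuotientGroup.mk'_surjective _), ← map_pPow]
    exact mem_map_of_mem _ hg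
  obtain ⟨x, hx⟩ := exists_pow_eq_of_mem_pPow_top
    (mk_pow_eq_of_powerful hp hodd h _ le_rfl) hq
  obtain ⟨x, rfl⟩ := QuotientGroup.mk_surjective x
  rw [← QuotientGroup.mk_pow, QuotientGroup.eq] at hx
  by_cases hx' : zpowers x = ⊤
  · exact exists_pow_eq_of_mem_pPow_top
      (fun a b => (commute_of_zpowers_eq_top hx' a b).mul_pow p) hg
  · have hgS : g ∈ pPow p (zpowers x ⊔ pPow p (⊤ : Subgroup G)) := by
      rw [← mul_inv_cancel_left (x ^ p) g]
      exact mul_mem (pow_mem_pPow (le_sup_left (b := pPow p (⊤ : Subgroup G)) (mem_zpowers x)))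
        (pPow_mono (le_sup_right (a := zpowers x)) hx)
    obtain ⟨z, -, hz⟩ := exists_pow_eq_of_mem_pPow_subtype hgS fun u hu =>
      ih _ (hn ▸ card_lt_of_ne_top (sup_pPow_ne_top hp hG hx')) (hG.to_subgroup _)
        (powerful_zpowers_sup hn1 (commutator_pPow_top_le hp hodd h) x) hu rfl
    exact ⟨z, hz⟩

theorem exists_pow_eq_of_mem_iterPow_succ [Finite G] (hp : p.Prime) (hodd : Odd p)
    (hG : IsPGroup p G) {N : Subgroup G} [hN : N.Normal] (h : ⁅N, (⊤ : Subgroup G)⁆ ≤ pPow p N)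
    {a : ℕ} {u : G} (hu : u ∈ iterPow p N (a + 1)) : ∃ z ∈ iterPow p N a, z ^ p = u := by
  have := Fact.mk hp
  have := hG.isNilpotent
  refine exists_pow_eq_of_mem_pPow_subtype hu fun v hv =>
    Powerful.exists_pow_eq hp hodd (hG.to_subgroup _) (powerful_subtype_iff.2 ?_) hv
  exact (commutator_mono le_rfl le_top).trans (commutator_iterPow_le hp hodd h a)

theorem exists_pow_eq_of_mem_iterPow [Finite G] (hp : p.Prime) (hodd : Odd p)
    (hG : IsPGroup p G) {N : Subgroup G} [hN : N.Normal] (h : ⁅N, (⊤ : Subgroup G)⁆ ≤ pPow p N)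
    {a : ℕ} {u : G} (hu : u ∈ iterPow p N a) : ∃ z ∈ N, z ^ p ^ a = u := by
  induction a generalizing u with
  | zero => exact ⟨u, hu, by simp⟩
  | succ a ih =>
    obtain ⟨z, hz, rfl⟩ := exists_pow_eq_of_mem_iterPow_succ hp hodd hG h hu
    obtain ⟨w, hw, rfl⟩ := ih hz
    exact ⟨w, hw, by rw [pow_succ, pow_mul]⟩

theorem exists_iterPow_eq_bot [Finite G] (hp : p.Prime) (hodd : Odd p)
    (hG : IsPGroup p G) {N : Subgroup G} [hN : N.Normal] (h : ⁅N, (⊤ : Subgroup G)⁆ ≤ pPow p N) :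
    ∃ a, iterPow p N a = ⊥ := by
  have := Fact.mk hp
  obtain ⟨n, hn⟩ := IsPGroup.iff_card.1 hG
  refine ⟨n, (eq_bot_iff_forall _).2 fun u hu => ?_⟩
  obtain ⟨z, -, rfl⟩ := exists_pow_eq_of_mem_iterPow hp hodd hG h hu
  rw [← hn]
  exact pow_card_eq_one'

end Powerful

section Omega

variable {p : ℕ} {G : Type*} [Group G]

/-- The elements of `N` of order dividing `n`, when they are closed under multiplication. -/
def torsionIn (N : Subgroup G) (n : ℕ)
    (h : ∀ x ∈ N, ∀ y ∈ N, x ^ n = 1 → y ^ n = 1 → (x * y) ^ n = 1) : Subgroup G where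
  carrier := {x | x ∈ N ∧ x ^ n = 1}
  one_mem' := ⟨one_mem N, one_pow n⟩
  mul_mem' := fun hx hy => ⟨mul_mem hx.1 hy.1, h _ hx.1 _ hy.1 hx.2 hy.2⟩
  inv_mem' := fun hx => ⟨inv_mem hx.1, by rw [inv_pow, hx.2, inv_one]⟩

theorem mem_torsionIn {N : Subgroup G} {n : ℕ}
    {h : ∀ x ∈ N, ∀ y ∈ N, x ^ n = 1 → y ^ n = 1 → (x * y) ^ n = 1} {x : G} :
    x ∈ torsionIn N n h ↔ x ∈ N ∧ x ^ n = 1 := Iff.rfl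

theorem conj_pow_eq_one {x : G} {n : ℕ} (h : x ^ n = 1) (g : G) : (g * x * g⁻¹) ^ n = 1 := by
  rw [conj_pow, h, mul_one, mul_inv_cancel]

theorem torsionIn_normal {N : Subgroup G} (hN : N.Normal) {n : ℕ}
    (h : ∀ x ∈ N, ∀ y ∈ N, x ^ n = 1 → y ^ n = 1 → (x * y) ^ n = 1) :
    (torsionIn N n h).Normal :=
  ⟨fun x hx g => ⟨hN.conj_mem x hx.1 g, conj_pow_eq_one hx.2 g⟩⟩

theorem pow_mul_closed_of_subtype {S : Subgroup G} {n : ℕ}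
    (h : ∀ x y : S, x ^ n = 1 → y ^ n = 1 → (x * y) ^ n = 1) :
    ∀ x ∈ S, ∀ y ∈ S, x ^ n = 1 → y ^ n = 1 → (x * y) ^ n = 1 := fun x hx y hy h1 h2 =>
  congrArg Subtype.val (h ⟨x, hx⟩ ⟨y, hy⟩ (Subtype.ext h1) (Subtype.ext h2))

theorem pow_pow_eq_one_of_le {x : G} {a b : ℕ} (h : x ^ p ^ a = 1) (hab : a ≤ b) :
    x ^ p ^ b = 1 := by
  obtain ⟨c, rfl⟩ := Nat.exists_eq_add_of_le hab
  rw [pow_add, pow_mul, h, one_pow]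

/-- In a powerful `p`-group the elements of order `p` form a subgroup, and an element of order
`p` of the `p ^ (a + 1)`-th power subgroup commutes with all elements of order at most
`p ^ (a + 1)`. -/
theorem Powerful.omega_one_and_commute [Finite G] (hp : p.Prime) (hodd : Odd p)
    (hG : IsPGroup p G) (h : Powerful p G) :
    (∀ x y : G, x ^ p = 1 → y ^ p = 1 → (x * y) ^ p = 1) ∧
      ∀ (a : ℕ) (u w : G), u ∈ iterPow p ⊤ (a + 1) → u ^ p = 1 → w ^ p ^ (a + 1) = 1 →
        Commute u w := by
  induction hn : Nat.card G using Nat.strong_induction_on generalizing G with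
  | _ n ih =>
  have := Fact.mk hp
  have := hG.isNilpotent
  set P : Subgroup G := pPow p ⊤ with hP
  have hPn : P.Normal := pPow_normal p inferInstance
  have hcP : ∀ g w : G, ⁅g, w⁆ ∈ P := fun g w =>
    h (commutator_mem_commutator (mem_top g) (mem_top w))
  have hS : ∀ w : G, ∀ x ∈ zpowers w ⊔ P, ∀ y ∈ zpowers w ⊔ P, x ^ p = 1 → y ^ p = 1 →
      (x * y) ^ p = 1 := by
    intro w
    by_cases hw : zpowers w = ⊤
    · intro x _ y _ hx hy
      rw [(commute_of_zpowers_eq_top hw x y).mul_pow, hx, hy, one_mul]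
    · exact pow_mul_closed_of_subtype
        (ih _ (hn ▸ card_lt_of_ne_top (sup_pPow_ne_top hp hG hw)) (hG.to_subgroup _)
          (powerful_zpowers_sup hPn (commutator_pPow_top_le hp hodd h) w) rfl).1
  have hPcl : ∀ x ∈ P, ∀ y ∈ P, x ^ p = 1 → y ^ p = 1 → (x * y) ^ p = 1 :=
    fun x hx y hy => hS 1 x (le_sup_right (a := zpowers (1 : G)) hx) y
      (le_sup_right (a := zpowers (1 : G)) hy)
  have hcm : ∀ g w : G, w ^ p = 1 → ⁅g, w⁆ ^ p = 1 := by
    intro g w hw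
    have hwS : w ∈ zpowers w ⊔ P := le_sup_left (a := zpowers w) (mem_zpowers w)
    have hgw : g * w * g⁻¹ ∈ zpowers w ⊔ P := by
      have : g * w * g⁻¹ = ⁅g, w⁆ * w := by simp only [commutatorElement_def]; group
      rw [this]
      exact mul_mem (le_sup_right (a := zpowers w) (hcP g w)) hwS
    exact hS w _ hgw _ (inv_mem hwS) (conj_pow_eq_one hw g) (by rw [inv_pow, hw, inv_one])
  obtain ⟨B, hB⟩ := exists_iterPow_eq_bot hp hodd hG (N := (⊤ : Subgroup G)) h
  have hγ : ∀ n a : ℕ, B ≤ a + n → ∀ u w : G, u ∈ iterPow p ⊤ (a + 1) → u ^ p = 1 →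
      w ^ p ^ (a + 1) = 1 → Commute u w := by
    intro n
    induction n with
    | zero =>
      intro a ha u w hu _ _
      have : u ∈ iterPow p (⊤ : Subgroup G) B := iterPow_antitone _ (by omega) hu
      rw [hB, mem_bot] at this
      rw [this]
      exact Commute.one_left w
    | succ n ihn =>
      intro a ha u w hu hup hw
      obtain ⟨z, hz, rfl⟩ := exists_pow_eq_of_mem_iterPow_succ hp hodd hG
        (N := (⊤ : Subgroup G)) h hu
      have hzz : z ^ p ^ 2 = 1 := by rw [pow_two, pow_mul, hup]
      have hd : ⁅z⁻¹, w⁆ ∈ iterPow p (⊤ : Subgroup G) (a + 1) :=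
        commutator_iterPow_le hp hodd h a (commutator_mem_commutator (inv_mem hz) (mem_top w))
      have hdp : ⁅z⁻¹, w⁆ ^ p = 1 ∨ z ^ p = 1 := by
        cases a with
        | zero => exact Or.inl (hcm _ _ (by simpa using hw))
        | succ a =>
          have hQn := torsionIn_normal hPn hPcl
          have huQ : z ^ p ∈ torsionIn P p hPcl := 
            ⟨iterPow_antitone (⊤ : Subgroup G) (show 1 ≤ a + 1 + 1 by omega) hu, hup⟩
          by_cases hQ : torsionIn P p hPcl = ⊥
          · rw [hQ, mem_bot] at huQ
            exact Or.inr huQ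
          · have hz' : (z : G ⧸ torsionIn P p hPcl) ∈
                iterPow p (⊤ : Subgroup (G ⧸ torsionIn P p hPcl)) (a + 1) := by
              rw [← map_top_of_surjective _ (QuotientGroup.mk'_surjective _), ← map_iterPow]
              exact mem_map_of_mem _ hz
            have := (ih _ (hn ▸ card_quotient_lt_of_ne_bot hQ) (hG.to_quotient _)
              (h.quotient _) rfl).2 a z w hz'
              (by rwa [← QuotientGroup.mk_pow, QuotientGroup.eq_one_iff])
              (by
                rw [← QuotientGroup.mk_pow, QuotientGroup.eq_one_iff]
                refine ⟨?_, by rw [← pow_mul, ← pow_succ, hw]⟩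
                rw [pow_succ, pow_mul]
                exact pow_mem_pPow (mem_top _))
            have hmem : ⁅z⁻¹, w⁆ ∈ torsionIn P p hPcl :=
              commutatorElement_mem_iff.2 (by simpa using this.inv_left)
            exact Or.inl hmem.2
      obtain hdp | hz1 := hdp
      swap
      · rw [hz1]; exact Commute.one_left w
      set d := ⁅z⁻¹, w⁆ with hd_def
      have hq : ⁅d⁻¹, z⁻¹⁆ ∈ iterPow p (⊤ : Subgroup G) (a + 1 + 1) :=
        commutator_iterPow_le hp hodd h (a + 1)
          (commutator_mem_commutator (inv_mem hd) (mem_top _))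
      have hdi : d⁻¹ ^ p = 1 := by rw [inv_pow, hdp, inv_one]
      have hqp : ⁅d⁻¹, z⁻¹⁆ ^ p = 1 := by
        rw [← commutatorElement_inv, inv_pow, hcm _ _ hdi, inv_one]
      have hqz := ihn (a + 1) (by omega) _ z hq hqp (pow_pow_eq_one_of_le hzz (by omega))
      have hqd := ihn (a + 1) (by omega) _ d hq hqp
        (pow_pow_eq_one_of_le (a := 1) (by rwa [pow_one]) (by omega))
      have key := mul_pow_prime_of_commute_commutator hp hodd
        (show d * z = z * d * ⁅d⁻¹, z⁻¹⁆ by simp only [commutatorElement_def]; group) hqz hqd hqp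
      have e : z * d = w * z * w⁻¹ := by
        simp only [hd_def, commutatorElement_def]; group
      rw [e, conj_pow, hdp, mul_one] at key
      exact (mul_inv_eq_iff_eq_mul.1 key).symm
  refine ⟨fun x y hx hy => ?_, fun a => hγ B a (by omega)⟩
  have hq : ⁅y⁻¹, x⁻¹⁆ ^ p = 1 := hcm _ _ (by rw [inv_pow, hx, inv_one])
  rw [mul_pow_prime_of_commute_commutator hp hodd
    (show y * x = x * y * ⁅y⁻¹, x⁻¹⁆ by simp only [commutatorElement_def]; group)
    (hγ B 0 (by omega) _ x (hcP _ _) hq (by simpa using hx))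
    (hγ B 0 (by omega) _ y (hcP _ _) hq (by simpa using hy)) hq, hx, hy, one_mul]

/-- In a powerful `p`-group the elements of order dividing `p ^ i` form a subgroup. -/
theorem Powerful.mul_pow_eq_one [Finite G] (hp : p.Prime) (hodd : Odd p)
    (hG : IsPGroup p G) (h : Powerful p G) {i : ℕ} {x y : G} (hx : x ^ p ^ i = 1)
    (hy : y ^ p ^ i = 1) : (x * y) ^ p ^ i = 1 := by
  induction i generalizing G with
  | zero => simp_all
  | succ i ih =>
    have hcl : ∀ x ∈ (⊤ : Subgroup G), ∀ y ∈ (⊤ : Subgroup G), x ^ p = 1 → y ^ p = 1 →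
      (x * y) ^ p = 1 := fun x _ y _ => (h.omega_one_and_commute hp hodd hG).1 x y
    have hn := torsionIn_normal (inferInstanceAs (⊤ : Subgroup G).Normal) hcl
    have key : ∀ z : G, z ^ p ^ (i + 1) = 1 ↔ (z : G ⧸ torsionIn ⊤ p hcl) ^ p ^ i = 1 := by
      intro z
      rw [← QuotientGroup.mk_pow, QuotientGroup.eq_one_iff, mem_torsionIn, ← pow_mul, ← pow_succ]
      simp
    rw [key] at *
    rw [QuotientGroup.mk_mul]
    exact ih (hG.to_quotient _) (h.quotient _) hx hy

theorem Powerful.commutator_pow_eq_one [Finite G] (hp : p.Prime) (hodd : Odd p)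
    (hG : IsPGroup p G) (h : Powerful p G) {a m : ℕ} {u x : G} (hu : u ∈ iterPow p ⊤ (a + 1))
    (hum : u ^ p ^ (m + 1) = 1) (hx : x ^ p ^ (m + a + 1) = 1) : ⁅u, x⁆ ^ p ^ m = 1 := by
  induction m generalizing G with
  | zero =>
    rw [pow_zero, pow_one, commutatorElement_eq_one_iff_commute]
    exact (h.omega_one_and_commute hp hodd hG).2 a u x hu (by simpa using hum)
      (by simpa using hx)
  | succ m ih =>
    have hcl : ∀ x ∈ (⊤ : Subgroup G), ∀ y ∈ (⊤ : Subgroup G), x ^ p = 1 → y ^ p = 1 →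
      (x * y) ^ p = 1 := fun x _ y _ => (h.omega_one_and_commute hp hodd hG).1 x y
    have hn := torsionIn_normal (inferInstanceAs (⊤ : Subgroup G).Normal) hcl
    have key : ∀ (i : ℕ) (z : G),
        z ^ p ^ (i + 1) = 1 ↔ (z : G ⧸ torsionIn ⊤ p hcl) ^ p ^ i = 1 := by
      intro i z
      rw [← QuotientGroup.mk_pow, QuotientGroup.eq_one_iff, mem_torsionIn, ← pow_mul, ← pow_succ]
      simp
    rw [key]
    refine ih (u := (u : G ⧸ torsionIn ⊤ p hcl)) (x := (x : G ⧸ torsionIn ⊤ p hcl))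
      (hG.to_quotient _) (h.quotient _) ?_ ((key _ _).1 hum)
      ((key _ _).1 (by convert hx using 3; omega))
    rw [← map_top_of_surjective _ (QuotientGroup.mk'_surjective _), ← map_iterPow]
    exact mem_map_of_mem _ hu

end Omega

section Eta

variable {p : ℕ} {G : Type*} [Group G]

theorem le_etaUp_succ {N : Subgroup G} (hN : N.Normal) {j : ℕ}
    (h : ⁅N, (⊤ : Subgroup G)⁆ ≤ pPow p N ⊔ etaUp p G j) : N ≤ etaUp p G (j + 1) :=
  le_sSup (show N ∈ {N : Subgroup G |
    N.Normal ∧ ⁅N, (⊤ : Subgroup G)⁆ ≤ pPow p N ⊔ etaUp p G j} from ⟨hN, h⟩)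

theorem commutator_etaUp_succ_le (j : ℕ) :
    ⁅etaUp p G (j + 1), (⊤ : Subgroup G)⁆ ≤ pPow p (etaUp p G (j + 1)) ⊔ etaUp p G j := by
  have : (pPow p (etaUp p G (j + 1))).Normal := pPow_normal p inferInstance
  exact commutator_sSup_le fun N hN =>
    hN.2.trans (sup_le_sup_right (pPow_mono (le_etaUp_succ hN.1 hN.2)) _)

theorem upperCentralSeries_le_etaUp (n : ℕ) : Subgroup.upperCentralSeries G n ≤ etaUp p G n := by
  induction n with
  | zero => rw [Subgroup.upperCentralSeries_zero]; exact bot_le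
  | succ n ih =>
    refine le_etaUp_succ inferInstance (le_trans ?_ (le_sup_right.trans' ih))
    rw [commutator_le]
    intro x hx y _
    exact Subgroup.mem_upperCentralSeries_succ_iff.1 hx y

theorem etaUp_pwc [Group.IsNilpotent G] : etaUp p G (pwc p G) = ⊤ := by
  obtain ⟨n, hn⟩ := Group.IsNilpotent.nilpotent G
  exact Nat.sInf_mem (s := {k | etaUp p G k = ⊤})
    ⟨n, top_le_iff.1 (hn ▸ upperCentralSeries_le_etaUp n)⟩

theorem commutator_etaUp_add_two_le [Group.IsNilpotent G] (hp : p.Prime) (hodd : Odd p) (j : ℕ) :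
    ⁅etaUp p G (j + 2), (⊤ : Subgroup G)⁆ ≤ etaUp p G (j + 1) := by
  set A := etaUp p G (j + 2)
  set D := pPow p A ⊔ etaUp p G (j + 1) with hD
  have hA : (pPow p A).Normal := pPow_normal p inferInstance
  have hDn : D.Normal := sup_normal _ _
  have hpD : (pPow p D).Normal := pPow_normal p hDn
  have hAD : ⁅A, (⊤ : Subgroup G)⁆ ≤ D := commutator_etaUp_succ_le (j + 1)
  refine hAD.trans (le_etaUp_succ hDn (commutator_top_le_of_le_sup ?_))
  refine commutator_sup_le ((commutator_pPow_le hp hodd A).trans ?_) ?_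
  · exact sup_le_sup (le_sup_of_le_left (pPow_mono hAD))
      (commutator_mono (commutator_mono hAD le_rfl) le_rfl)
  · exact (commutator_etaUp_succ_le j).trans
      (le_sup_of_le_left (sup_le_sup_right (pPow_mono le_sup_right) _))

theorem lowerCentralSeries_le_etaUp_one [Group.IsNilpotent G] (hp : p.Prime) (hodd : Odd p)
    {c : ℕ} (h : etaUp p G (c + 1) = ⊤) :
    (⊤ : Subgroup G).lowerCentralSeries c ≤ etaUp p G 1 := by
  have key : ∀ t s, t + s = c → (⊤ : Subgroup G).lowerCentralSeries t ≤ etaUp p G (s + 1) := by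
    intro t
    induction t with
    | zero =>
      rintro s rfl
      rw [zero_add] at h
      exact h.ge
    | succ t ih =>
      intro s hs
      exact (commutator_mono (ih (s + 1) (by omega)) le_rfl).trans
        (commutator_etaUp_add_two_le hp hodd s)
  exact key c 0 rfl

theorem commutator_etaUp_one_le :
    ⁅etaUp p G 1, (⊤ : Subgroup G)⁆ ≤ pPow p (etaUp p G 1) :=
  (commutator_etaUp_succ_le 0).trans (sup_le le_rfl bot_le)

/-- If the `c`-th lower central term of `H = ⟨g | g ^ (p ^ i) = 1⟩` lies in a powerfully embedded
subgroup `P`, then the later terms descend through the iterated power subgroups of `P` and have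
decreasing exponent. -/
theorem lowerCentralSeries_closure_torsion [Finite G] (hp : p.Prime) (hodd : Odd p)
    (hG : IsPGroup p G) {P : Subgroup G} [hPn : P.Normal]
    (hP : ⁅P, (⊤ : Subgroup G)⁆ ≤ pPow p P) {i c : ℕ}
    (hc : (closure {g : G | g ^ p ^ i = 1}).lowerCentralSeries c ≤ P) (a : ℕ) :
    ∀ u ∈ (closure {g : G | g ^ p ^ i = 1}).lowerCentralSeries (c + a + 1),
      u ∈ iterPow p P (a + 1) ∧ u ^ p ^ (i - a) = 1 := by
  have := Fact.mk hp
  have := hG.isNilpotent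
  have hPp : Powerful p P := powerful_subtype_iff.2 ((commutator_mono le_rfl le_top).trans hP)
  have hcl : ∀ b n, ∀ x ∈ iterPow p P b, ∀ y ∈ iterPow p P b, x ^ p ^ n = 1 → y ^ p ^ n = 1 →
      (x * y) ^ p ^ n = 1 := fun b n x hx y hy =>
    pow_mul_closed_of_subtype (fun _ _ => hPp.mul_pow_eq_one hp hodd (hG.to_subgroup _)) x
      (iterPow_antitone P (Nat.zero_le b) hx) y (iterPow_antitone P (Nat.zero_le b) hy)
  have step : ∀ b n m, (closure {g : G | g ^ p ^ i = 1}).lowerCentralSeries n ≤ iterPow p P b →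
      (∀ u ∈ (closure {g : G | g ^ p ^ i = 1}).lowerCentralSeries n,
        ∀ x : G, x ^ p ^ i = 1 → ⁅u, x⁆ ^ p ^ m = 1) →
      ∀ u ∈ (closure {g : G | g ^ p ^ i = 1}).lowerCentralSeries (n + 1),
        u ∈ iterPow p P (b + 1) ∧ u ^ p ^ m = 1 := by
    intro b n m hb hm
    have := torsionIn_normal (iterPow_normal hPn (b + 1)) (hcl (b + 1) (m))
    refine commutator_closure_right_le (T := torsionIn _ _ (hcl (b + 1) m)) fun u hu x hx => ?_
    exact ⟨commutator_iterPow_le hp hodd hP b (commutator_mem_commutator (hb hu) (mem_top x)),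
      hm u hu x hx⟩
  have hK := fun x : G => powerful_zpowers_sup hPn hP x
  induction a with
  | zero =>
    refine step 0 c i hc fun u hu x hx => ?_
    have hxK : x ∈ zpowers x ⊔ P := le_sup_left (a := zpowers x) (mem_zpowers x)
    have huK : u ∈ zpowers x ⊔ P := le_sup_right (a := zpowers x) (hc hu)
    exact pow_mul_closed_of_subtype
      (fun _ _ => (hK x).mul_pow_eq_one hp hodd (hG.to_subgroup _)) _
      (mul_mem (mul_mem huK hxK) (inv_mem huK)) _ (inv_mem hxK) (conj_pow_eq_one hx u)
      (by rw [inv_pow, hx, inv_one])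
  | succ a ih =>
    refine step (a + 1) (c + a + 1) (i - (a + 1)) (fun u hu => (ih u hu).1) fun u hu x hx => ?_
    obtain ⟨huP, hut⟩ := ih u hu
    obtain h0 | ⟨m, hm⟩ : i - a = 0 ∨ ∃ m, i = m + a + 1 := by
      by_cases h : i ≤ a
      · exact Or.inl (by omega)
      · exact Or.inr ⟨i - a - 1, by omega⟩
    · rw [h0, pow_zero, pow_one] at hut
      rw [hut, commutatorElement_one_left, one_pow]
    · subst hm
      rw [show m + a + 1 - a = m + 1 by omega] at hut
      rw [show m + a + 1 - (a + 1) = m by omega]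
      have huK : u ∈ (iterPow p (⊤ : Subgroup (zpowers x ⊔ P : Subgroup G)) (a + 1)).map
          (zpowers x ⊔ P).subtype := by
        rw [map_iterPow, ← MonoidHom.range_eq_map, range_subtype]
        exact iterPow_mono le_sup_right _ huP
      obtain ⟨v, hv, rfl⟩ := huK
      have := (hK x).commutator_pow_eq_one hp hodd (hG.to_subgroup _) (m := m) hv
        (x := ⟨x, le_sup_left (a := zpowers x) (mem_zpowers x)⟩)
        (Subtype.ext hut) (Subtype.ext hx)
      exact congrArg Subtype.val this

end Eta

/-- A filtration of subgroups compatible with commutators. -/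
structure CommFiltration (G : Type u) [Group G] where
  /-- The terms of the filtration. -/
  term : ℕ → Subgroup G
  antitone_term : Antitone term
  commutator_term_le : ∀ m n, ⁅term m, term n⁆ ≤ term (m + n)

namespace CommFiltration

variable {G : Type u} [Group G]

theorem commutator_mem (J : CommFiltration G) {m n k : ℕ} {x y : G} (hx : x ∈ J.term m)
    (hy : y ∈ J.term n) (hk : m + n = k) : ⁅x, y⁆ ∈ J.term k :=
  hk ▸ J.commutator_term_le m n (commutator_mem_commutator hx hy)

theorem conj_mem (J : CommFiltration G) {m n : ℕ} {g x : G} (hg : g ∈ J.term m)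
    (hx : x ∈ J.term n) : g * x * g⁻¹ ∈ J.term n := by
  have e : g * x * g⁻¹ = ⁅g, x⁆ * x := by simp only [commutatorElement_def]; group
  rw [e]
  exact mul_mem (J.antitone_term (Nat.le_add_left n m) (J.commutator_mem hg hx rfl)) hx

theorem conj_mem' (J : CommFiltration G) {m n : ℕ} {g x : G} (hg : g ∈ J.term m)
    (hx : x ∈ J.term n) : g⁻¹ * x * g ∈ J.term n := by
  simpa using J.conj_mem (inv_mem hg) hx

/-- The filtration on `G × G` of pairs congruent modulo the next term. -/
def arrow (J : CommFiltration G) : CommFiltration (G × G) where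
  term d :=
    { carrier := {x | x.1 ∈ J.term d ∧ x.1⁻¹ * x.2 ∈ J.term (d + 1)}
      one_mem' := ⟨one_mem _, by simp⟩
      mul_mem' := by
        rintro ⟨a, b⟩ ⟨a', b'⟩ ⟨ha, hb⟩ ⟨ha', hb'⟩
        refine ⟨mul_mem ha ha', ?_⟩
        have e : (a * a')⁻¹ * (b * b') = a'⁻¹ * (a⁻¹ * b) * a' * (a'⁻¹ * b') := by group
        show (a * a')⁻¹ * (b * b') ∈ _
        rw [e]
        exact mul_mem (J.conj_mem' ha' hb) hb'
      inv_mem' := by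
        rintro ⟨a, b⟩ ⟨ha, hb⟩
        refine ⟨inv_mem ha, ?_⟩
        have e : a⁻¹⁻¹ * b⁻¹ = a * (a⁻¹ * b)⁻¹ * a⁻¹ := by group
        show a⁻¹⁻¹ * b⁻¹ ∈ _
        rw [e]
        exact J.conj_mem ha (inv_mem hb) }
  antitone_term m n h _ hx :=
    ⟨J.antitone_term h hx.1, J.antitone_term (Nat.succ_le_succ h) hx.2⟩
  commutator_term_le m n := by
    rw [commutator_le]
    rintro ⟨a, b⟩ ⟨ha, hb⟩ ⟨a', b'⟩ ⟨ha', hb'⟩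
    refine ⟨J.commutator_mem ha ha' rfl, ?_⟩
    have hbn : b' ∈ J.term n := by
      rw [← mul_inv_cancel_left a' b']
      exact mul_mem ha' (J.antitone_term (Nat.le_succ n) hb')
    have e : ⁅a, a'⁆⁻¹ * ⁅b, b'⁆ =
        ⁅a, a'⁆⁻¹ * (a * ⁅a⁻¹ * b, b'⁆ * a⁻¹) * ⁅a, a'⁆ *
          (a' * ⁅a, a'⁻¹ * b'⁆ * a'⁻¹) := by
      simp only [commutatorElement_def]; group
    show ⁅a, a'⁆⁻¹ * ⁅b, b'⁆ ∈ _
    rw [e]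
    refine mul_mem (J.conj_mem' (J.commutator_mem ha ha' rfl) (J.conj_mem ha ?_))
      (J.conj_mem ha' ?_)
    · exact J.commutator_mem hb hbn (by omega)
    · exact J.commutator_mem ha hb' (by omega)

theorem mem_arrow {J : CommFiltration G} {d : ℕ} {a b : G} :
    ((a, b) : G × G) ∈ J.arrow.term d ↔ a ∈ J.term d ∧ a⁻¹ * b ∈ J.term (d + 1) := Iff.rfl

/-- Sequences that remain in the zeroth term after `n` iterations of the arrow construction. -/
def IsPoly : ∀ (_ : ℕ) {G : Type u} [Group G], CommFiltration G → (ℕ → G) → Prop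
  | 0, _, _, J, f => ∀ t, f t ∈ J.term 0
  | n + 1, _, _, J, f => IsPoly n J.arrow fun t => (f t, f (t + 1))

theorem IsPoly.mul {n : ℕ} {J : CommFiltration G} {f g : ℕ → G} (hf : IsPoly n J f)
    (hg : IsPoly n J g) : IsPoly n J fun t => f t * g t := by
  induction n generalizing G with
  | zero => exact fun t => mul_mem (hf t) (hg t)
  | succ n ih => exact ih (J := J.arrow) hf hg

theorem IsPoly.inv {n : ℕ} {J : CommFiltration G} {f : ℕ → G} (hf : IsPoly n J f) :
    IsPoly n J fun t => (f t)⁻¹ := by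
  induction n generalizing G with
  | zero => exact fun t => inv_mem (hf t)
  | succ n ih => exact ih (J := J.arrow) hf

theorem isPoly_pow_mul (n : ℕ) {J : CommFiltration G} {a b : G} (ha : a ∈ J.term 1)
    (hb : b ∈ J.term 0) : IsPoly n J fun t => a ^ t * b := by
  induction n generalizing G with
  | zero => exact fun t => mul_mem (pow_mem (J.antitone_term zero_le_one ha) t) hb
  | succ n ih =>
    have h := ih (J := J.arrow) (a := (a, a)) (b := (b, a * b))
      (mem_arrow.2 ⟨ha, by simp⟩)
      (mem_arrow.2 ⟨hb, by rw [← mul_assoc]; exact J.conj_mem' hb ha⟩)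
    have e : (fun t => (a ^ t * b, a ^ (t + 1) * b)) = fun t => (a, a) ^ t * (b, a * b) := by
      funext t
      simp [pow_succ, mul_assoc]
    exact (congrArg (IsPoly n J.arrow) e).mpr h

theorem isPoly_pow_choose (n : ℕ) {J : CommFiltration G} {r : ℕ} {c : G} (hc : c ∈ J.term r) :
    IsPoly n J fun t => c ^ t.choose r := by
  induction n generalizing G r with
  | zero => exact fun t => pow_mem (J.antitone_term (Nat.zero_le r) hc) _
  | succ n ih =>
    have hcc : ((c, c) : G × G) ∈ J.arrow.term r := mem_arrow.2 ⟨hc, by simp⟩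
    cases r with
    | zero =>
      have e : (fun t : ℕ => (c ^ t.choose 0, c ^ (t + 1).choose 0)) =
          fun t => (c, c) ^ t.choose 0 := by
        funext t
        simp
      exact (congrArg (IsPoly n J.arrow) e).mpr (ih hcc)
    | succ s =>
      have e : (fun t : ℕ => (c ^ t.choose (s + 1), c ^ (t + 1).choose (s + 1))) =
          fun t => (c, c) ^ t.choose (s + 1) * (1, c) ^ t.choose s := by
        funext t
        simp [Nat.choose_succ_succ', ← pow_add, add_comm]
      exact (congrArg (IsPoly n J.arrow) e).mpr
        ((ih hcc).mul (ih (mem_arrow.2 ⟨one_mem _, by simpa using hc⟩)))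

theorem IsPoly.apply_mem {r : ℕ} {J : CommFiltration G} {f : ℕ → G} (hf : IsPoly r J f)
    (h : ∀ t < r, f t = 1) : f r ∈ J.term r := by
  induction r generalizing G with
  | zero => exact hf 0
  | succ r ih =>
    have := ih (J := J.arrow) hf fun t ht => by
      rw [h t (by omega), h (t + 1) (by omega)]; rfl
    simpa [h r (by omega)] using (mem_arrow.1 this).2

theorem apply_eq_one_of_isPoly {J : CommFiltration G} {N : ℕ} (d : ℕ) {s : ℕ}
    (hs : s + d = N + 1) (hJ : ∀ r, s ≤ r → r ≤ N → ∀ w ∈ J.term r, w ^ N.choose r = 1)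
    {f : ℕ → G} (hf : ∀ n, IsPoly n J f) (h : ∀ t < s, f t = 1) : f N = 1 := by
  induction d generalizing s f with
  | zero => exact h N (by omega)
  | succ d ih =>
    have hc := (hf s).apply_mem h
    have := ih (s := s + 1) (by omega) (fun r hr => hJ r (by omega))
      (f := fun t => f t * (f s ^ t.choose s)⁻¹)
      (fun n => (hf n).mul (isPoly_pow_choose n hc).inv) fun t ht => by
        obtain ht | rfl := Nat.lt_succ_iff_lt_or_eq.1 ht
        · simp [h t ht, Nat.choose_eq_zero_of_lt ht]
        · simp
    simpa [hJ s le_rfl (by omega) _ hc] using this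

/-- A consequence of the Hall–Petrescu formula. -/
theorem mul_pow_eq_one (J : CommFiltration G) {y z : G} (hy : y ∈ J.term 1) (hz : z ∈ J.term 1)
    {N : ℕ} (hyN : y ^ N = 1) (hzN : z ^ N = 1)
    (hJ : ∀ r, 2 ≤ r → r ≤ N → ∀ w ∈ J.term r, w ^ N.choose r = 1) : (y * z) ^ N = 1 := by
  obtain rfl | hN := Nat.eq_zero_or_pos N
  · exact pow_zero _
  have hpow : ∀ a ∈ J.term 1, ∀ n, IsPoly n J fun t => a ^ t := fun a ha n => by
    simpa using isPoly_pow_mul n ha (one_mem (J.term 0))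
  have := apply_eq_one_of_isPoly (N := N) (N - 1) (s := 2) (by omega) hJ
    (f := fun t => (z ^ t)⁻¹ * (y ^ t)⁻¹ * (y * z) ^ t)
    (fun n => ((hpow z hz n).inv.mul (hpow y hy n).inv).mul (hpow _ (mul_mem hy hz) n))
    fun t ht => by
      interval_cases t
      · simp
      · simp
  simpa [hyN, hzN] using this

end CommFiltration

section Exponent

variable {p : ℕ} {G : Type*} [Group G]

theorem lowerCentralSeries_normal' (H : Subgroup G) [H.Normal] (n : ℕ) :
    (H.lowerCentralSeries n).Normal := by
  induction n with
  | zero => assumption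
  | succ n ih => exact commutator_normal _ _

theorem commutator_lowerCentralSeries_le (H : Subgroup G) [H.Normal] (a b : ℕ) :
    ⁅H.lowerCentralSeries a, H.lowerCentralSeries b⁆ ≤ H.lowerCentralSeries (a + b + 1) := by
  induction b generalizing a with
  | zero => exact le_rfl
  | succ b ih =>
    have := lowerCentralSeries_normal' H (a + (b + 1) + 1)
    rw [commutator_comm]
    refine commutator_commutator_le_of_rotate ?_ ?_
    · rw [commutator_comm H]
      refine (ih (a + 1)).trans (le_of_eq ?_)
      congr 1
      omega
    · exact commutator_mono (ih a) le_rfl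

/-- The filtration `⟨x⟩γ_n(H), ⟨x⟩γ_n(H), γ_{n+1}(H), γ_{n+2}(H), …`. -/
def zpowersSupFiltration {G : Type*} [Group G] (H : Subgroup G) [H.Normal] {x : G} (hx : x ∈ H)
    (n : ℕ) : CommFiltration G where
  term
    | 0 => zpowers x ⊔ H.lowerCentralSeries n
    | 1 => zpowers x ⊔ H.lowerCentralSeries n
    | r + 2 => H.lowerCentralSeries (n + r + 1)
  antitone_term := antitone_nat_of_succ_le fun r => by
    match r with
    | 0 => exact le_rfl
    | 1 =>
      exact le_sup_of_le_right (Subgroup.lowerCentralSeries_antitone _ (Nat.le_succ n))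
    | r + 2 => exact Subgroup.lowerCentralSeries_antitone _ (by omega)
  commutator_term_le a b := by
    have hn := lowerCentralSeries_normal' H
    have hL : zpowers x ⊔ H.lowerCentralSeries n ≤ H :=
      sup_le (zpowers_le.2 hx) (lowerCentralSeries_le_self H n)
    have h1 : ∀ m, ⁅zpowers x ⊔ H.lowerCentralSeries n, H.lowerCentralSeries m⁆ ≤
        H.lowerCentralSeries (m + 1) := fun m => by
      rw [commutator_comm]
      exact commutator_mono le_rfl hL
    have hLL : ⁅zpowers x ⊔ H.lowerCentralSeries n, zpowers x ⊔ H.lowerCentralSeries n⁆ ≤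
        H.lowerCentralSeries (n + 1) := by
      have := hn (n + 1)
      refine commutator_sup_le ?_ (commutator_mono le_rfl hL)
      rw [commutator_comm]
      refine commutator_sup_le ?_ (commutator_mono le_rfl (zpowers_le.2 hx))
      rw [commutator_self_eq_bot_iff.2 inferInstance]
      exact bot_le
    have h0 : H.lowerCentralSeries (n + 1) ≤ zpowers x ⊔ H.lowerCentralSeries n :=
      le_sup_of_le_right (Subgroup.lowerCentralSeries_antitone _ (Nat.le_succ n))
    have hmono : ∀ {s t : ℕ}, s ≤ t → H.lowerCentralSeries t ≤ H.lowerCentralSeries s :=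
      fun h => Subgroup.lowerCentralSeries_antitone _ h
    match a, b with
    | 0, 0 => exact hLL.trans h0
    | 0, 1 => exact hLL.trans h0
    | 1, 0 => exact hLL.trans h0
    | 1, 1 => exact hLL
    | 0, b + 2 => rw [zero_add]; exact (h1 _).trans (hmono (by omega))
    | b + 2, 0 => rw [commutator_comm]; exact (h1 _).trans (hmono (by omega))
    | 1, b + 2 =>
      rw [show 1 + (b + 2) = (b + 1) + 2 by omega]
      exact (h1 _).trans (hmono (by omega))
    | b + 2, 1 =>
      rw [commutator_comm, show b + 2 + 1 = (b + 1) + 2 by omega]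
      exact (h1 _).trans (hmono (by omega))
    | a + 2, b + 2 =>
      rw [show a + 2 + (b + 2) = (a + b + 2) + 2 by omega]
      exact (commutator_lowerCentralSeries_le H _ _).trans (hmono (by omega))

theorem exists_pow_dvd_choose_prime_pow (hp : p.Prime) {m r : ℕ} (hr : 0 < r) (hrm : r ≤ p ^ m) :
    ∃ v ≤ m, p ^ v ≤ r ∧ p ^ (m - v) ∣ (p ^ m).choose r := by
  obtain ⟨v, r', hr', rfl⟩ := Nat.exists_eq_pow_mul_and_not_dvd hr.ne' p hp.ne_one
  have hle : p ^ v ≤ p ^ v * r' := Nat.le_mul_of_pos_right _ (Nat.pos_of_mul_pos_left hr)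
  have hv : v ≤ m := (Nat.pow_le_pow_iff_right hp.one_lt).1 (hle.trans hrm)
  refine ⟨v, hv, hle, ?_⟩
  have h := Nat.add_one_mul_choose_eq (p ^ m - 1) (p ^ v * r' - 1)
  rw [Nat.sub_add_cancel (pow_pos hp.pos m), Nat.sub_add_cancel hr] at h
  have h2 : p ^ v * (p ^ (m - v) * (p ^ m - 1).choose (p ^ v * r' - 1)) =
      p ^ v * ((p ^ m).choose (p ^ v * r') * r') := by
    rw [← mul_assoc, ← pow_add, Nat.add_sub_cancel' hv, h]
    ring
  have h3 := Nat.eq_of_mul_eq_mul_left (pow_pos hp.pos v) h2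
  exact (((hp.coprime_iff_not_dvd).2 hr').pow_left _).dvd_of_dvd_mul_right (Dvd.intro _ h3)

/-- The exponents of the lower central terms of `H = ⟨g | g ^ (p ^ i) = 1⟩`, given that the terms
from `c + 1` on have the exponents of the power subgroups of a powerfully embedded subgroup. -/
theorem lowerCentralSeries_pow_eq_one (hp : p.Prime) {i c : ℕ}
    (hc : ∀ a, ∀ u ∈ (closure {g : G | g ^ p ^ i = 1}).lowerCentralSeries (c + a + 1),
      u ^ p ^ (i - a) = 1) (n m : ℕ) (hnm : c + 1 + i * (p - 1) ≤ n + m * (p - 1)) :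
    ∀ z ∈ (closure {g : G | g ^ p ^ i = 1}).lowerCentralSeries n, z ^ p ^ m = 1 := by
  obtain ⟨q, rfl⟩ : ∃ q, p = q + 1 := ⟨p - 1, (Nat.sub_add_cancel hp.pos).symm⟩
  rw [Nat.add_sub_cancel] at hnm
  have hq : 1 ≤ q := Nat.le_of_lt_succ hp.one_lt
  set p := q + 1 with hpq
  set X := {g : G | g ^ p ^ i = 1} with hX
  have hHn : (closure X).Normal := by
    refine ⟨fun x hx g => ?_⟩
    have : closure X ≤ (closure X).comap (MulAut.conj g).toMonoidHom := by
      rw [closure_le]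
      exact fun y hy => subset_closure (show (g * y * g⁻¹) ^ p ^ i = 1 from conj_pow_eq_one hy g)
    exact this hx
  have hΓn := lowerCentralSeries_normal' (closure X)
  obtain ⟨d, hd⟩ : ∃ d, c + 1 ≤ n + d := ⟨c + 1, by omega⟩
  induction d using Nat.strong_induction_on generalizing n m with
  | _ d ih =>
  by_cases hcn : c + 1 ≤ n
  · obtain ⟨a, rfl⟩ := Nat.exists_eq_add_of_le hcn
    intro z hz
    rw [show c + 1 + a = c + a + 1 by omega] at hz
    refine pow_pow_eq_one_of_le (hc a z hz) ?_
    by_contra! hlt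
    have h1 : m + a + 1 ≤ i := by omega
    nlinarith [Nat.mul_le_mul_right q h1]
  have hmi : i ≤ m := by
    by_contra! hlt
    nlinarith [Nat.mul_le_mul_right q hlt.le]
  have hX' : ∀ x ∈ X, x ^ p ^ m = 1 := fun x hx => pow_pow_eq_one_of_le hx hmi
  have hbin : ∀ r, 2 ≤ r → r ≤ p ^ m → ∀ w ∈ (closure X).lowerCentralSeries (n + (r - 2) + 1),
      w ^ (p ^ m).choose r = 1 := by
    intro r hr hrm w hw
    obtain ⟨v, hvm, hvr, e, he⟩ := exists_pow_dvd_choose_prime_pow hp (by omega : 0 < r) hrm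
    have hb : 1 + v * q ≤ p ^ v := by
      clear_value p
      subst hpq
      clear * -
      induction v with
      | zero => simp
      | succ v ih =>
        rw [pow_succ]
        nlinarith [Nat.mul_le_mul_right (q + 1) ih, Nat.zero_le (v * q * q)]
    have hmv : (m - v) * q + v * q = m * q := by
      rw [← add_mul, Nat.sub_add_cancel hvm]
    rw [he, pow_mul, ih (d - 1) (by omega) (n + (r - 2) + 1) (m - v) (by omega) (by omega) w hw,
      one_pow]
  have hmul : ∀ x ∈ closure X, ∀ y ∈ zpowers x ⊔ (closure X).lowerCentralSeries n,
      ∀ z ∈ zpowers x ⊔ (closure X).lowerCentralSeries n,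
      y ^ p ^ m = 1 → z ^ p ^ m = 1 → (y * z) ^ p ^ m = 1 := by
    intro x hx y hy z hz hyN hzN
    refine (zpowersSupFiltration (closure X) hx n).mul_pow_eq_one hy hz hyN hzN ?_
    intro r hr hrN w hw
    obtain ⟨r, rfl⟩ := Nat.exists_eq_add_of_le' hr
    exact hbin (r + 2) hr hrN w hw
  have hcl : ∀ y ∈ (closure X).lowerCentralSeries n, ∀ z ∈ (closure X).lowerCentralSeries n,
      y ^ p ^ m = 1 → z ^ p ^ m = 1 → (y * z) ^ p ^ m = 1 := fun y hy z hz =>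
    hmul 1 (one_mem _) y (le_sup_right (a := zpowers (1 : G)) hy) z
      (le_sup_right (a := zpowers (1 : G)) hz)
  suffices h : (closure X).lowerCentralSeries n ≤ torsionIn _ (p ^ m) hcl from
    fun z hz => (h hz).2
  cases n with
  | zero =>
    exact (closure_le _).2 fun x hx => ⟨subset_closure hx, hX' x hx⟩
  | succ n =>
    have := torsionIn_normal (hΓn (n + 1)) hcl
    refine commutator_closure_right_le (T := torsionIn _ _ hcl) fun u hu x hx => ?_
    have hxH : x ∈ closure X := subset_closure hx
    have hux : ⁅u, x⁆ ∈ (closure X).lowerCentralSeries (n + 1) :=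
      commutator_mem_commutator hu hxH
    have hxL : x ∈ zpowers x ⊔ (closure X).lowerCentralSeries (n + 1) :=
      le_sup_left (a := zpowers x) (mem_zpowers x)
    have huxL : u * x * u⁻¹ ∈ zpowers x ⊔ (closure X).lowerCentralSeries (n + 1) := by
      have e : u * x * u⁻¹ = ⁅u, x⁆ * x := by simp only [commutatorElement_def]; group
      rw [e]
      exact mul_mem (le_sup_right (a := zpowers x) hux) hxL
    exact ⟨hux, hmul x hxH _ huxL _ (inv_mem hxL) (conj_pow_eq_one (hX' x hx) u)
      (by rw [inv_pow, hX' x hx, inv_one])⟩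

end Exponent

end OmegaBound

/-- if `G` has powerful class `k ≤ ℓ(p-1)`, then `Ω_i(G)^{p^{i+ℓ}} = 1`. -/
theorem omega_exponent_bound {p : ℕ} (hp : p.Prime) (hodd : Odd p)
    {G : Type*} [Group G] [Finite G] (hG : IsPGroup p G)
    {k l i : ℕ} (hk : pwc p G = k) (hkl : k ≤ l * (p - 1)) :
    ∀ x ∈ Subgroup.closure {g : G | g ^ p ^ i = 1}, x ^ p ^ (i + l) = 1 := by
  have := Fact.mk hp
  have := hG.isNilpotent
  have htop : etaUp p G k = ⊤ := hk ▸ OmegaBound.etaUp_pwc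
  obtain _ | c := k
  · intro x _
    have hx : x ∈ etaUp p G 0 := htop ▸ Subgroup.mem_top x
    rw [Subgroup.mem_bot.1 hx, one_pow]
  · have hP : (Subgroup.closure {g : G | g ^ p ^ i = 1}).lowerCentralSeries c ≤ etaUp p G 1 :=
      (Subgroup.lowerCentralSeries_mono c le_top).trans
        (OmegaBound.lowerCentralSeries_le_etaUp_one hp hodd htop)
    refine OmegaBound.lowerCentralSeries_pow_eq_one hp (c := c) (fun a u hu =>
      (OmegaBound.lowerCentralSeries_closure_torsion hp hodd hG
        OmegaBound.commutator_etaUp_one_le hP a u hu).2) 0 (i + l) ?_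
    rw [add_mul]
    omega
end

section
/- Let p be an odd prime and G a finite p-group of maximal class (order p^n, nilpotency class n−1, n ≥ 4). Then η(G) = Z(G). -/
open scoped commutatorElement

open Subgroup in
/-- The centralizer of `A` modulo the normal subgroup `K`. -/
def centralizerMod {G : Type*} [Group G] (K : Subgroup G) [K.Normal] (A : Set G) : Subgroup G :=
  (centralizer (QuotientGroup.mk' K '' A)).comap (QuotientGroup.mk' K)

theorem commutatorElement_mem_iff_commute {G : Type*} [Group G] (K : Subgroup G) [K.Normal]
    (x y : G) : ⁅x, y⁆ ∈ K ↔ Commute (x : G ⧸ K) (y : G ⧸ K) := by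
  rw [← commutatorElement_eq_one_iff_commute, ← QuotientGroup.eq_one_iff]
  rfl

theorem commutatorElement_mem_comm {G : Type*} [Group G] {K : Subgroup G} [K.Normal]
    {x y : G} : ⁅x, y⁆ ∈ K ↔ ⁅y, x⁆ ∈ K := by
  rw [← commutatorElement_inv, inv_mem_iff]

theorem mem_centralizerMod {G : Type*} [Group G] {K : Subgroup G} [K.Normal] {A : Set G} {x : G} :
    x ∈ centralizerMod K A ↔ ∀ a ∈ A, ⁅x, a⁆ ∈ K := by
  simp only [centralizerMod, Subgroup.mem_comap, Subgroup.mem_centralizer_iff,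
    Set.forall_mem_image, commutatorElement_mem_iff_commute]
  exact forall₂_congr fun a _ => eq_comm

/-- If `G = C ⟨g⟩`, where `C / K` is the center of `G / K`, then `G / K` is abelian. -/
theorem centralizerMod_univ_eq_top {G : Type*} [Group G] {K : Subgroup G} [K.Normal] {g : G}
    (h : Subgroup.zpowers g ⊔ centralizerMod K Set.univ = ⊤) :
    centralizerMod K (Set.univ : Set G) = ⊤ := by
  have hg : g ∈ centralizerMod K (Set.univ : Set G) := by
    have h1 : (⊤ : Subgroup G) ≤ centralizerMod K {g} := by
      rw [← h, sup_le_iff, Subgroup.zpowers_le]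
      refine ⟨mem_centralizerMod.2 (by simp), fun x hx => mem_centralizerMod.2 fun a _ => ?_⟩
      exact mem_centralizerMod.1 hx a trivial
    refine mem_centralizerMod.2 fun a _ => commutatorElement_mem_comm.1 ?_
    exact mem_centralizerMod.1 (h1 (Subgroup.mem_top a)) g rfl
  rwa [sup_eq_right.2 (Subgroup.zpowers_le.2 hg)] at h

theorem commutatorElement_pow_left {H : Type*} [Group H] {x g c e : H} (hc : ⁅x, g⁆ = c)
    (he : ⁅x, c⁆ = e) (hex : Commute e x) (hec : Commute e c) (k : ℕ) :
    ⁅x ^ k, g⁆ = c ^ k * e ^ k.choose 2 := by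
  have hconj : x * c * x⁻¹ = e * c := by rw [← he]; group
  have hconj' : x * e * x⁻¹ = e := by rw [← hex.eq]; group
  induction k with
  | zero => simp
  | succ k ih =>
    calc ⁅x ^ (k + 1), g⁆ = x * ⁅x ^ k, g⁆ * x⁻¹ * ⁅x, g⁆ := by
          simp only [commutatorElement_def, pow_succ']; group
      _ = (x * c * x⁻¹) ^ k * (x * e * x⁻¹) ^ k.choose 2 * c := by
          rw [ih, hc, conj_pow, conj_pow]; group
      _ = (e ^ k * c ^ k) * e ^ k.choose 2 * c := by
          rw [hconj, hconj', hec.mul_pow]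
      _ = c ^ (k + 1) * e ^ (k + 1).choose 2 := by
          rw [Nat.choose_succ_succ' k 1, Nat.choose_one_right, pow_add e, (hec.pow_pow k k).eq,
            mul_assoc, (hec.pow_left _).eq, mul_assoc, ← mul_assoc (e ^ k),
            (hec.pow_left _).eq, pow_succ]
          simp only [mul_assoc]

theorem commutatorElement_pow_mem_iff {G : Type*} [Group G] {K : Subgroup G} [K.Normal]
    {x g : G} {k : ℕ} (hx : ⁅⁅x, ⁅x, g⁆⁆, x⁆ ∈ K) (hc : ⁅⁅x, ⁅x, g⁆⁆, ⁅x, g⁆⁆ ∈ K)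
    (he : ⁅x, ⁅x, g⁆⁆ ^ k.choose 2 ∈ K) : ⁅x ^ k, g⁆ ∈ K ↔ ⁅x, g⁆ ^ k ∈ K := by
  have h := commutatorElement_pow_left (H := G ⧸ K) (x := x) (g := g) rfl rfl
    ((commutatorElement_mem_iff_commute K _ _).1 hx)
    ((commutatorElement_mem_iff_commute K _ _).1 hc) k
  rw [← QuotientGroup.eq_one_iff] at he
  rw [← QuotientGroup.eq_one_iff, ← QuotientGroup.eq_one_iff]
  have h2 : ((⁅x ^ k, g⁆ : G) : G ⧸ K) = ((⁅x, g⁆ ^ k : G) : G ⧸ K) := by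
    refine h.trans ?_
    have he' : ⁅(x : G ⧸ K), ⁅(x : G ⧸ K), (g : G ⧸ K)⁆⁆ ^ k.choose 2 = 1 := he
    rw [he', mul_one]
    rfl
  rw [h2]

/-- If `A / K` is abelian and generated by elements of order dividing `k`, it has exponent
dividing `k`. -/
theorem pow_mem_of_le_closure {G : Type*} [Group G] {K A : Subgroup G} [K.Normal] {S : Set G}
    {k : ℕ} (hA : ⁅A, A⁆ ≤ K) (hSA : S ⊆ A) (hS : A ≤ Subgroup.closure S)
    (hk : ∀ s ∈ S, s ^ k ∈ K) : ∀ a ∈ A, a ^ k ∈ K := by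
  suffices h : ∀ a ∈ Subgroup.closure S, a ∈ A ∧ a ^ k ∈ K from fun a ha => (h a (hS ha)).2
  intro a ha
  induction ha using Subgroup.closure_induction with
  | mem x hx => exact ⟨hSA hx, hk x hx⟩
  | one => simp
  | mul x y _ _ hx hy =>
    refine ⟨mul_mem hx.1 hy.1, ?_⟩
    have hcomm := (commutatorElement_mem_iff_commute K x y).1
      (hA (Subgroup.commutator_mem_commutator hx.1 hy.1))
    have h2 := hcomm.mul_pow k
    rw [← QuotientGroup.eq_one_iff]
    have hx' : (x : G ⧸ K) ^ k = 1 := (QuotientGroup.eq_one_iff _).2 hx.2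
    have hy' : (y : G ⧸ K) ^ k = 1 := (QuotientGroup.eq_one_iff _).2 hy.2
    rw [hx', hy', one_mul] at h2
    exact h2
  | inv x _ hx => exact ⟨inv_mem hx.1, by rw [inv_pow]; exact inv_mem hx.2⟩

theorem zpowers_sup_eq_of_relIndex_prime {G : Type*} [Group G] {A B : Subgroup G}
    (hAB : A ≤ B) (hp : (A.relIndex B).Prime) {c : G} (hcB : c ∈ B) (hcA : c ∉ A) :
    Subgroup.zpowers c ⊔ A = B := by
  have hX : Subgroup.zpowers c ⊔ A ≤ B := sup_le (Subgroup.zpowers_le.2 hcB) hAB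
  have hmul := Subgroup.relIndex_mul_relIndex A _ B
    (le_sup_right : A ≤ Subgroup.zpowers c ⊔ A) hX
  refine le_antisymm hX (Subgroup.relIndex_eq_one.1 ?_)
  have hne : A.relIndex (Subgroup.zpowers c ⊔ A) ≠ 1 := fun h =>
    hcA (Subgroup.relIndex_eq_one.1 h (Subgroup.mem_sup_left (Subgroup.mem_zpowers c)))
  rw [((Nat.dvd_prime hp).1 (Dvd.intro _ hmul)).resolve_left hne] at hmul
  exact (Nat.mul_eq_left hp.ne_zero).1 hmul

/-- The `i`-th term of the lower central series of `G`, starting from `lcs G 0 = G`. -/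
abbrev lcs (G : Type*) [Group G] (i : ℕ) : Subgroup G :=
  (⊤ : Subgroup G).lowerCentralSeries i

theorem commutator_lowerCentralSeries_one_le {G : Type*} [Group G] (k : ℕ) :
    ⁅lcs G 1, lcs G k⁆ ≤ lcs G (k + 2) := by
  let f := QuotientGroup.mk' (lcs G (k + 2))
  have hle (A B : Subgroup G) : ⁅A, B⁆ ≤ lcs G (k + 2) ↔ ⁅A.map f, B.map f⁆ = ⊥ := by
    rw [← Subgroup.map_commutator, Subgroup.map_eq_bot_iff, QuotientGroup.ker_mk']
  have h1 : ⁅lcs G k, (⊤ : Subgroup G)⁆ = lcs G (k + 1) := rfl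
  have h2 : ⁅lcs G (k + 1), (⊤ : Subgroup G)⁆ = lcs G (k + 2) := rfl
  rw [hle, show lcs G 1 = ⁅(⊤ : Subgroup G), ⊤⁆ from rfl, Subgroup.map_commutator]
  apply Subgroup.commutator_commutator_eq_bot_of_rotate
  · rw [← Subgroup.map_commutator, ← hle, Subgroup.commutator_comm ⊤, h1, h2]
  · rw [← Subgroup.map_commutator, ← hle, h1, h2]

theorem lcs_commutator {G : Type*} [Group G] (i : ℕ) :
    ⁅lcs G i, (⊤ : Subgroup G)⁆ = lcs G (i + 1) :=
  rfl

theorem lcs_anti {G : Type*} [Group G] {i j : ℕ} (h : i ≤ j) : lcs G j ≤ lcs G i :=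
  Subgroup.lowerCentralSeries_antitone _ h

theorem commutatorElement_mem_lcs {G : Type*} [Group G] {i : ℕ} {x : G} (hx : x ∈ lcs G i) (g : G) :
    ⁅x, g⁆ ∈ lcs G (i + 1) :=
  Subgroup.commutator_mem_commutator hx (Subgroup.mem_top g)

theorem lcs_succ_lt {G : Type*} [Group G] [Group.IsNilpotent G] {i : ℕ}
    (hi : i < Group.nilpotencyClass G) : lcs G (i + 1) < lcs G i := by
  refine lt_of_le_of_ne (lcs_anti i.le_succ) fun h => ?_
  have hk (k : ℕ) : lcs G (i + k) = lcs G i := by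
    induction k with
    | zero => rfl
    | succ k ih => rw [← add_assoc, ← lcs_commutator, ih, lcs_commutator, h]
  have hbot : lcs G i = ⊥ := by
    rw [← hk (Group.nilpotencyClass G - i), Nat.add_sub_cancel' hi.le]
    exact Subgroup.lowerCentralSeries_nilpotencyClass
  exact hi.not_ge (Subgroup.lowerCentralSeries_eq_bot_iff_nilpotencyClass_le.1 hbot)

theorem lcs_one_le_centralizerMod {G : Type*} [Group G] :
    lcs G 1 ≤ centralizerMod (lcs G 2) Set.univ := fun _ hx =>
  mem_centralizerMod.2 fun g _ => commutatorElement_mem_lcs hx g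

theorem zpowers_sup_centralizerMod_ne_top {G : Type*} [Group G] [Group.IsNilpotent G]
    (hG : 1 < Group.nilpotencyClass G) (x : G) :
    Subgroup.zpowers x ⊔ centralizerMod (lcs G 2) Set.univ ≠ ⊤ := fun h => by
  refine (lcs_succ_lt hG).not_ge ?_
  refine Subgroup.commutator_le.2 fun a _ b _ => ?_
  have ha : a ∈ centralizerMod (lcs G 2) Set.univ := by
    rw [centralizerMod_univ_eq_top h]
    exact Subgroup.mem_top a
  exact mem_centralizerMod.1 ha b trivial

theorem zpowers_sup_lcs_one_ne_top {G : Type*} [Group G] [Group.IsNilpotent G]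
    (hG : 1 < Group.nilpotencyClass G) (x : G) : Subgroup.zpowers x ⊔ lcs G 1 ≠ ⊤ := fun h =>
  zpowers_sup_centralizerMod_ne_top hG x
    (top_le_iff.1 (h.ge.trans (sup_le_sup_left lcs_one_le_centralizerMod _)))

theorem lt_zpowers_sup {G : Type*} [Group G] {A : Subgroup G} {x : G} (hx : x ∉ A) :
    A < Subgroup.zpowers x ⊔ A :=
  lt_of_le_of_ne le_sup_right fun h => hx (h ▸ Subgroup.mem_sup_left (Subgroup.mem_zpowers x))

/-- Modulo `γ_{i+2}(G)`, commutation with an element of `γ_i(G)` is a homomorphism. -/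
def commutatorHom {G : Type*} [Group G] (i : ℕ) {c : G} (hc : c ∈ lcs G i) :
    G →* G ⧸ lcs G (i + 2) where
  toFun x := (⁅x, c⁆ : G)
  map_one' := by rw [commutatorElement_one_left, QuotientGroup.mk_one]
  map_mul' x y := by
    have hy : ⁅y, c⁆ ∈ lcs G (i + 1) :=
      commutatorElement_mem_comm.1 (commutatorElement_mem_lcs hc y)
    have hcomm (z : G) : Commute ((⁅y, c⁆ : G) : G ⧸ lcs G (i + 2)) z :=
      (commutatorElement_mem_iff_commute (lcs G (i + 2)) _ _).1 (commutatorElement_mem_lcs hy z)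
    have h : ⁅x * y, c⁆ = x * ⁅y, c⁆ * x⁻¹ * ⁅x, c⁆ := by
      simp only [commutatorElement_def]; group
    rw [h]
    change (x : G ⧸ lcs G (i + 2)) * (⁅y, c⁆ : G) * (x : G ⧸ lcs G (i + 2))⁻¹ * (⁅x, c⁆ : G) = _
    rw [← (hcomm x).eq, mul_inv_cancel_right, (hcomm _).eq]

section MaximalClass

variable {p : ℕ} {G : Type*} [Group G] [Finite G] [Group.IsNilpotent G] {n : ℕ}

theorem card_lcs (hp : p.Prime) (hn : 3 ≤ n) (hcard : Nat.card G = p ^ n)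
    (hclass : Group.nilpotencyClass G = n - 1) {i : ℕ} (hi : 1 ≤ i) (hin : i ≤ n - 1) :
    Nat.card (lcs G i) = p ^ (n - 1 - i) := by
  have hex (H : Subgroup G) : ∃ k, Nat.card H = p ^ k :=
    let ⟨k, _, hk⟩ := (Nat.dvd_prime_pow hp).1 (hcard ▸ H.card_subgroup_dvd_card)
    ⟨k, hk⟩
  choose f hf using hex
  have hlt {A B : Subgroup G} (h : A < B) : f A < f B := by
    have h1 : Nat.card A < Nat.card B :=
      Set.Finite.card_lt_card (Set.toFinite (B : Set G)) h
    rw [hf, hf] at h1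
    exact (Nat.pow_lt_pow_iff_right hp.one_lt).1 h1
  have htop : f ⊤ = n := Nat.pow_right_injective hp.two_le (by
    change p ^ f ⊤ = p ^ n
    rw [← hf, Subgroup.card_top, hcard])
  have hstep {i : ℕ} (hi : i < n - 1) : f (lcs G (i + 1)) < f (lcs G i) :=
    hlt (lcs_succ_lt (hclass ▸ hi))
  have hone : f (lcs G 1) ≤ n - 2 := by
    obtain ⟨x, hx⟩ : ∃ x, x ∉ lcs G 1 := by
      by_contra! h
      exact (lcs_succ_lt (i := 0) (by omega)).not_ge fun x _ => h x
    have h2 := hlt (zpowers_sup_lcs_one_ne_top (by omega) x).lt_top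
    have h3 := hlt (lt_zpowers_sup hx)
    omega
  have hupper : f (lcs G i) ≤ n - 1 - i := by
    induction i, hi using Nat.le_induction with
    | base => omega
    | succ i hi ih => have := ih (by omega); have := hstep (i := i) (by omega); omega
  have hlower : n - 1 - i ≤ f (lcs G i) := by
    clear hi hupper
    induction h : n - 1 - i generalizing i with
    | zero => omega
    | succ k ih => have := @ih (i + 1) (by omega) (by omega); have := hstep (i := i) (by omega); omega
  rw [hf, le_antisymm hupper hlower]

theorem relIndex_lcs (hp : p.Prime) (hn : 3 ≤ n) (hcard : Nat.card G = p ^ n)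
    (hclass : Group.nilpotencyClass G = n - 1) {i : ℕ} (hi : 1 ≤ i) (hin : i + 1 ≤ n - 1) :
    (lcs G (i + 1)).relIndex (lcs G i) = p := by
  have h := Subgroup.relIndex_mul_relIndex ⊥ _ _ bot_le (lcs_anti (G := G) i.le_succ)
  rw [Subgroup.relIndex_bot_left, Subgroup.relIndex_bot_left,
    card_lcs hp hn hcard hclass (by omega) hin, card_lcs hp hn hcard hclass hi (by omega),
    show n - 1 - i = n - 1 - (i + 1) + 1 by omega, pow_succ] at h
  exact Nat.eq_of_mul_eq_mul_left (pow_pos hp.pos _) h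

/-- A subgroup strictly between `γ₂(G)` and `G` has index `p` in `G`. -/
theorem relIndex_lcs_one (hp : p.Prime) (hn : 3 ≤ n) (hcard : Nat.card G = p ^ n)
    (hclass : Group.nilpotencyClass G = n - 1) {X : Subgroup G} (h1 : lcs G 1 < X) (h2 : X ≠ ⊤) :
    (lcs G 1).relIndex X = p ∧ X.index = p := by
  have h : (lcs G 1).index = p ^ 2 := by
    have h := (lcs G 1).card_mul_index
    rw [card_lcs hp hn hcard hclass le_rfl (by omega), hcard,
      show p ^ n = p ^ (n - 1 - 1) * p ^ 2 by rw [← pow_add]; congr 1; omega] at h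
    exact Nat.eq_of_mul_eq_mul_left (pow_pos hp.pos _) h
  refine (hp.mul_eq_prime_sq_iff (fun h => h1.not_ge (Subgroup.relIndex_eq_one.1 h))
    (fun h => h2 (Subgroup.index_eq_one.1 h))).1 ?_
  rw [Subgroup.relIndex_mul_index h1.le, h]

theorem pow_mem_lcs_one (hp : p.Prime) (hn : 3 ≤ n) (hcard : Nat.card G = p ^ n)
    (hclass : Group.nilpotencyClass G = n - 1) (x : G) : x ^ p ∈ lcs G 1 := by
  by_cases hx : x ∈ lcs G 1
  · exact pow_mem hx p
  · rw [← (relIndex_lcs_one hp hn hcard hclass (lt_zpowers_sup hx)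
      (zpowers_sup_lcs_one_ne_top (by omega) x)).1]
    exact (lcs G 1).pow_relIndex_mem (Subgroup.mem_sup_left (Subgroup.mem_zpowers x))

theorem pow_mem_lcs_succ (hp : p.Prime) (hn : 3 ≤ n) (hcard : Nat.card G = p ^ n)
    (hclass : Group.nilpotencyClass G = n - 1) {i : ℕ} (hi : 1 ≤ i) (hin : i + 1 ≤ n - 1) {x : G}
    (hx : x ∈ lcs G i) : x ^ p ∈ lcs G (i + 1) := by
  have h := (lcs G (i + 1)).pow_relIndex_mem hx
  rwa [relIndex_lcs hp hn hcard hclass hi hin] at h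

theorem zpowers_sup_lcs_succ (hp : p.Prime) (hn : 3 ≤ n) (hcard : Nat.card G = p ^ n)
    (hclass : Group.nilpotencyClass G = n - 1) {i : ℕ} (hi : 1 ≤ i) (hin : i + 1 ≤ n - 1) {c : G}
    (hc : c ∈ lcs G i) (hc' : c ∉ lcs G (i + 1)) :
    Subgroup.zpowers c ⊔ lcs G (i + 1) = lcs G i :=
  zpowers_sup_eq_of_relIndex_prime (lcs_anti i.le_succ)
    ((relIndex_lcs hp hn hcard hclass hi hin).symm ▸ hp) hc hc'

theorem exists_commutatorElement_notMem_lcs_two (hp : p.Prime) (hn : 3 ≤ n)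
    (hcard : Nat.card G = p ^ n) (hclass : Group.nilpotencyClass G = n - 1) {y : G}
    (hy : y ∉ lcs G 1) : ∃ g, ⁅y, g⁆ ∉ lcs G 2 := by
  by_contra! h
  set Z := centralizerMod (lcs G 2) (Set.univ : Set G) with hZ
  have hyZ : y ∈ Z := mem_centralizerMod.2 fun g _ => h g
  have hne := zpowers_sup_centralizerMod_ne_top (G := G) (by omega)
  have hZtop : Z ≠ ⊤ := fun hZt => hne 1 (by rw [← hZ, hZt, sup_top_eq])
  obtain ⟨x, hx⟩ : ∃ x, x ∉ Z := by
    by_contra! hall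
    exact hZtop ((Subgroup.eq_top_iff' Z).2 hall)
  have hlt : lcs G 1 < Z :=
    lt_of_le_of_ne lcs_one_le_centralizerMod fun h => hy (h ▸ hyZ)
  have hidx := (relIndex_lcs_one hp hn hcard hclass hlt hZtop).2
  rw [← Subgroup.relIndex_top_right] at hidx
  exact hne x (zpowers_sup_eq_of_relIndex_prime le_top (hidx.symm ▸ hp) (Subgroup.mem_top x) hx)

theorem commutatorElement_pow_mem_lcs_three_iff (hp : p.Prime) (hodd : Odd p) (hn : 4 ≤ n)
    (hcard : Nat.card G = p ^ n) (hclass : Group.nilpotencyClass G = n - 1) (x g : G) :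
    ⁅x ^ p, g⁆ ∈ lcs G 3 ↔ ⁅x, g⁆ ^ p ∈ lcs G 3 := by
  have hc : ⁅x, g⁆ ∈ lcs G 1 := commutatorElement_mem_lcs (i := 0) (Subgroup.mem_top x) g
  have he : ⁅x, ⁅x, g⁆⁆ ∈ lcs G 2 :=
    commutatorElement_mem_comm.1 (commutatorElement_mem_lcs hc x)
  have hdvd : p ∣ p.choose 2 :=
    hp.dvd_choose_self two_ne_zero (lt_of_le_of_ne hp.two_le fun h => by
      rw [← h] at hodd
      exact absurd hodd (by decide))
  refine commutatorElement_pow_mem_iff (commutatorElement_mem_lcs he _)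
    (commutatorElement_mem_lcs he _) ?_
  obtain ⟨k, hk⟩ := hdvd
  rw [hk, pow_mul]
  exact pow_mem (pow_mem_lcs_succ hp (by omega) hcard hclass (by omega) (by omega) he) k

theorem exists_notMem_lcs_one_commutatorElement_mem (hp : p.Prime) (hn : 4 ≤ n)
    (hcard : Nat.card G = p ^ n) (hclass : Group.nilpotencyClass G = n - 1) {c : G}
    (hc : c ∈ lcs G 1) : ∃ x, x ∉ lcs G 1 ∧ ⁅x, c⁆ ∈ lcs G 3 := by
  have hout {X : Subgroup G} (hX : X ≠ ⊤) : ∃ x, x ∉ X := by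
    by_contra! hall
    exact hX ((Subgroup.eq_top_iff' X).2 hall)
  have hne := zpowers_sup_lcs_one_ne_top (G := G) (by omega)
  obtain ⟨u, hu⟩ := hout fun h : lcs G 1 = ⊤ => hne 1 (by rw [h, sup_top_eq])
  obtain ⟨v, hv⟩ := hout (hne u)
  by_cases huc : ⁅u, c⁆ ∈ lcs G 3
  · exact ⟨u, hu, huc⟩
  have hmem (y : G) : ⁅y, c⁆ ∈ lcs G 2 :=
    commutatorElement_mem_comm.1 (commutatorElement_mem_lcs hc y)
  have hvc := hmem v
  rw [← zpowers_sup_lcs_succ hp (by omega) hcard hclass (by omega) (by omega) (hmem u) huc,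
    Subgroup.mem_sup_of_normal_right] at hvc
  obtain ⟨-, ⟨k, rfl⟩, z, hz, hk⟩ := hvc
  refine ⟨v * u ^ (-k), fun h => hv ?_, ?_⟩
  · rw [← mul_inv_cancel_right v (u ^ (-k)), ← zpow_neg, neg_neg]
    exact mul_mem (Subgroup.mem_sup_right h)
      (Subgroup.mem_sup_left (Subgroup.zpow_mem_zpowers u k))
  · have hφ : commutatorHom 1 hc v = commutatorHom 1 hc u ^ k := by
      change ((⁅v, c⁆ : G) : G ⧸ lcs G 3) = ((⁅u, c⁆ ^ k : G) : G ⧸ lcs G 3)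
      rw [← hk, QuotientGroup.mk_mul_of_mem _ hz]
    rw [← QuotientGroup.eq_one_iff]
    change commutatorHom 1 hc (v * u ^ (-k)) = 1
    rw [map_mul, map_zpow, hφ, zpow_neg, mul_inv_cancel]

theorem pow_mem_lcs_three (hp : p.Prime) (hodd : Odd p) (hn : 4 ≤ n)
    (hcard : Nat.card G = p ^ n) (hclass : Group.nilpotencyClass G = n - 1) :
    ∀ a ∈ lcs G 1, a ^ p ∈ lcs G 3 := by
  obtain ⟨c, hc, hc2⟩ := SetLike.exists_of_lt (lcs_succ_lt (G := G) (i := 1) (by omega))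
  have hgen {d : G} (hd : d ∈ lcs G 1) (hd2 : d ∉ lcs G 2) :=
    zpowers_sup_lcs_succ hp (by omega) hcard hclass le_rfl (by omega) hd hd2
  obtain ⟨x, hx, hxc⟩ := exists_notMem_lcs_one_commutatorElement_mem hp hn hcard hclass hc
  have hcent : lcs G 1 ≤ centralizerMod (lcs G 3) {x} := by
    rw [← hgen hc hc2, sup_le_iff, Subgroup.zpowers_le]
    simp only [SetLike.le_def, mem_centralizerMod, Set.mem_singleton_iff, forall_eq]
    exact ⟨commutatorElement_mem_comm.1 hxc, fun y hy => commutatorElement_mem_lcs hy x⟩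
  obtain ⟨g, hg⟩ := exists_commutatorElement_notMem_lcs_two hp (by omega) hcard hclass hx
  rw [commutatorElement_mem_comm] at hg
  have hd : ⁅g, x⁆ ∈ lcs G 1 := commutatorElement_mem_lcs (i := 0) (Subgroup.mem_top g) x
  refine pow_mem_of_le_closure (S := {⁅g, x⁆} ∪ lcs G 2)
    (commutator_lowerCentralSeries_one_le 1) ?_ ?_ ?_
  · exact Set.union_subset (Set.singleton_subset_iff.2 hd) (lcs_anti one_le_two)
  · rw [Subgroup.closure_union, Subgroup.closure_eq, ← Subgroup.zpowers_eq_closure,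
      hgen hd hg]
  · rintro s (rfl | hs)
    · rw [← commutatorElement_pow_mem_lcs_three_iff hp hodd hn hcard hclass]
      exact mem_centralizerMod.1 (hcent (pow_mem_lcs_one hp (by omega) hcard hclass g)) x rfl
    · exact pow_mem_lcs_succ hp (by omega) hcard hclass (by omega) (by omega) hs

end MaximalClass

theorem pow_mem_lcs_add_two {G : Type*} [Group G] {k : ℕ}
    (hbase : ∀ a ∈ lcs G 1, a ^ k ∈ lcs G 3) {i : ℕ} (hi : 1 ≤ i) :
    ∀ a ∈ lcs G i, a ^ k ∈ lcs G (i + 2) := by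
  induction i, hi using Nat.le_induction with
  | base => exact hbase
  | succ i hi ih =>
    have hcomm := commutator_lowerCentralSeries_one_le (G := G) (i + 1)
    have hle := lcs_anti (G := G) hi
    refine pow_mem_of_le_closure
      (S := {g | ∃ g₁ ∈ lcs G i, ∃ g₂ ∈ (⊤ : Subgroup G), ⁅g₁, g₂⁆ = g})
      ((Subgroup.commutator_mono (lcs_anti (by omega)) le_rfl).trans hcomm)
      Subgroup.subset_closure le_rfl ?_
    rintro _ ⟨x, hx, g, -, rfl⟩
    have he : ⁅x, ⁅x, g⁆⁆ ∈ lcs G (i + 3) :=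
      hcomm (Subgroup.commutator_mem_commutator (hle hx) (commutatorElement_mem_lcs hx g))
    have he' (y : G) : ⁅⁅x, ⁅x, g⁆⁆, y⁆ ∈ lcs G (i + 3) :=
      lcs_anti (by omega) (commutatorElement_mem_lcs he y)
    rw [show i + 1 + 2 = i + 3 from rfl,
      ← commutatorElement_pow_mem_iff (he' _) (he' _) (pow_mem he _)]
    exact commutatorElement_mem_lcs (ih x hx) g

theorem commutator_sup_le {G : Type*} [Group G] {A B C K : Subgroup G} [K.Normal]
    (hA : ⁅A, C⁆ ≤ K) (hB : ⁅B, C⁆ ≤ K) : ⁅A ⊔ B, C⁆ ≤ K := by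
  have h (X : Subgroup G) : ⁅X, C⁆ ≤ K ↔ X ≤ centralizerMod K C := by
    rw [Subgroup.commutator_le]
    exact forall₂_congr fun x _ => mem_centralizerMod.symm
  rw [h] at *
  exact sup_le hA hB

theorem pPow_le_iff {G : Type*} [Group G] {p : ℕ} {N K : Subgroup G} :
    pPow p N ≤ K ↔ ∀ x ∈ N, x ^ p ∈ K := by
  rw [pPow, Subgroup.closure_le, Set.image_subset_iff]
  rfl

section MaximalClass

variable {p : ℕ} {G : Type*} [Group G] [Finite G] [Group.IsNilpotent G] {n : ℕ}

theorem le_lcs_one_of_commutator_le_pPow (hp : p.Prime) (hodd : Odd p) (hn : 4 ≤ n)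
    (hcard : Nat.card G = p ^ n) (hclass : Group.nilpotencyClass G = n - 1) {N : Subgroup G}
    (hN : ⁅N, (⊤ : Subgroup G)⁆ ≤ pPow p N) : N ≤ lcs G 1 := by
  intro y hy
  by_contra hy1
  obtain ⟨g, hg⟩ := exists_commutatorElement_notMem_lcs_two hp (by omega) hcard hclass hy1
  have hc1 : ⁅y, g⁆ ∈ lcs G 1 := commutatorElement_mem_lcs (i := 0) (Subgroup.mem_top y) g
  have hcent : pPow p N ≤ centralizerMod (lcs G 3) Set.univ := pPow_le_iff.2 fun x _ =>
    mem_centralizerMod.2 fun z _ =>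
      (commutatorElement_pow_mem_lcs_three_iff hp hodd hn hcard hclass x z).2
        (pow_mem_lcs_three hp hodd hn hcard hclass _
          (commutatorElement_mem_lcs (i := 0) (Subgroup.mem_top x) z))
  have hc := hcent (hN (Subgroup.commutator_mem_commutator hy (Subgroup.mem_top g)))
  refine (lcs_succ_lt (G := G) (i := 2) (by omega)).not_ge ?_
  rw [← lcs_commutator 1,
    ← zpowers_sup_lcs_succ hp (by omega) hcard hclass le_rfl (by omega) hc1 hg]
  refine commutator_sup_le (Subgroup.commutator_le.2 fun a ha b _ => ?_) le_rfl
  exact mem_centralizerMod.1 (Subgroup.zpowers_le.2 hc ha) b trivial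

theorem le_center_of_commutator_le_pPow (hp : p.Prime) (hodd : Odd p) (hn : 4 ≤ n)
    (hcard : Nat.card G = p ^ n) (hclass : Group.nilpotencyClass G = n - 1) {N : Subgroup G}
    (hN : ⁅N, (⊤ : Subgroup G)⁆ ≤ pPow p N) : N ≤ Subgroup.center G := by
  have hle (i : ℕ) (hi : i + 1 ≤ n - 2) : N ≤ lcs G (i + 1) := by
    induction i with
    | zero => exact le_lcs_one_of_commutator_le_pPow hp hodd hn hcard hclass hN
    | succ i ih =>
      have hNi := ih (by omega)
      intro y hy
      by_contra hyi
      have hp2 : pPow p N ≤ lcs G (i + 3) := pPow_le_iff.2 fun x hx =>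
        pow_mem_lcs_add_two (pow_mem_lcs_three hp hodd hn hcard hclass) (by omega) x (hNi hx)
      refine (lcs_succ_lt (G := G) (i := i + 2) (by omega)).not_ge ?_
      rw [← lcs_commutator (i + 1),
        ← zpowers_sup_lcs_succ hp (by omega) hcard hclass (by omega) (by omega) (hNi hy) hyi]
      refine commutator_sup_le ?_ le_rfl
      exact (Subgroup.commutator_mono (Subgroup.zpowers_le.2 hy) le_rfl).trans (hN.trans hp2)
  rw [← Subgroup.commutator_top_right_eq_bot_iff_le_center, eq_bot_iff,
    ← Subgroup.lowerCentralSeries_nilpotencyClass (G := G), hclass,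
    show n - 1 = n - 3 + 1 + 1 by omega]
  exact Subgroup.commutator_mono (hle (n - 3) (by omega)) le_rfl

end MaximalClass

/-- a finite `p`-group of maximal class satisfies `η(G) = Z(G)`. -/
theorem eta_of_maximal_class {p : ℕ} (hp : p.Prime) (hodd : Odd p)
    {G : Type*} [Group G] [Finite G] [Group.IsNilpotent G]
    {n : ℕ} (hn : 4 ≤ n) (hcard : Nat.card G = p ^ n)
    (hclass : Group.nilpotencyClass G = n - 1) :
    etaUp p G 1 = Subgroup.center G := by
  refine le_antisymm (sSup_le fun N hN => ?_) (le_sSup ⟨inferInstance, ?_⟩)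
  · refine le_center_of_commutator_le_pPow hp hodd hn hcard hclass ?_
    simpa only [etaUp, sup_bot_eq] using hN.2
  · rw [Subgroup.commutator_center_left]
    exact bot_le
end

section
/- Let p be an odd prime and G a finite p-group of maximal class of order p^n (n ≥ 4). Then η_i(G) = Z_i(G) for all i ≥ 0, and consequently the powerful class of G equals its nilpotency class n−1. -/
section PowerIdentities

open scoped commutatorElement

variable {G : Type*} [Group G]

theorem mul_pow_eq_of_mul_eq_of_forall_commute {x y e : G} (he : ∀ g, Commute e g)
    (h : y * x = x * y * e) (m : ℕ) : (x * y) ^ m = x ^ m * y ^ m * e ^ m.choose 2 := by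
  have hyx : ∀ m : ℕ, y ^ m * x = x * y ^ m * e ^ m := by
    intro m
    induction m with
    | zero => simp
    | succ m ih =>
      calc y ^ (m + 1) * x = y ^ m * (y * x) := by rw [pow_succ, mul_assoc]
        _ = (y ^ m * x) * (y * e) := by rw [h]; simp only [mul_assoc]
        _ = x * y ^ m * (e ^ m * y) * e := by rw [ih]; simp only [mul_assoc]
        _ = x * y ^ (m + 1) * e ^ (m + 1) := by
          rw [((he y).pow_left m).eq, pow_succ, pow_succ]; simp only [mul_assoc]
  induction m with
  | zero => simp
  | succ m ih =>
    calc (x * y) ^ (m + 1) = x ^ m * y ^ m * (e ^ m.choose 2 * (x * y)) := by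
          rw [pow_succ, ih]; simp only [mul_assoc]
      _ = x ^ m * (y ^ m * x) * y * e ^ m.choose 2 := by
          rw [((he (x * y)).pow_left _).eq]; simp only [mul_assoc]
      _ = x ^ m * x * y ^ m * (e ^ m * y) * e ^ m.choose 2 := by
          rw [hyx]; simp only [mul_assoc]
      _ = x ^ (m + 1) * y ^ (m + 1) * e ^ (m + 1).choose 2 := by
          rw [((he y).pow_left m).eq, show (m + 1).choose 2 = m.choose 1 + m.choose 2 from rfl,
            Nat.choose_one_right, pow_add e, pow_succ x m, pow_succ y m]
          simp only [mul_assoc]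

theorem pow_choose_two_eq_one {p : ℕ} (hodd : Odd p) {e : G} (he : e ^ p = 1) :
    e ^ p.choose 2 = 1 := by
  obtain ⟨k, rfl⟩ := hodd
  have : (2 * k + 1).choose 2 = (2 * k + 1) * k := by
    rw [Nat.choose_two_right, Nat.add_sub_cancel, mul_left_comm, Nat.mul_div_cancel_left _ two_pos]
  rw [this, pow_mul, he, one_pow]

/-- For odd `p`, commutators with `h` and `p`-th powers are compatible on `a` when `⁅⁅a, h⁆⁻¹, a⁆`
is central of exponent `p`. -/
theorem commutatorElement_pow_left_s19 {p : ℕ} (hodd : Odd p) {a h : G}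
    (hc : ∀ g, Commute ⁅⁅a, h⁆⁻¹, a⁆ g) (hp : ⁅⁅a, h⁆⁻¹, a⁆ ^ p = 1) :
    ⁅a ^ p, h⁆ = ⁅a, h⁆ ^ p := by
  have key := mul_pow_eq_of_mul_eq_of_forall_commute (x := a⁻¹) (y := ⁅a, h⁆) hc
    (by simp only [commutatorElement_def]; group) p
  rw [pow_choose_two_eq_one hodd hp, mul_one] at key
  calc ⁅a ^ p, h⁆ = a ^ p * (h * a⁻¹ * h⁻¹) ^ p := by
        rw [conj_pow, commutatorElement_def, inv_pow]; simp only [mul_assoc]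
    _ = a ^ p * (a⁻¹ * ⁅a, h⁆) ^ p := by
        congr 2; simp only [commutatorElement_def]; group
    _ = ⁅a, h⁆ ^ p := by rw [key, inv_pow]; group

end PowerIdentities

namespace Subgroup

open scoped commutatorElement

section UpperCentral

variable {G : Type*} [Group G]

theorem commute_mk_of_mem_upperCentralSeries_succ {i : ℕ} {e : G}
    (he : e ∈ upperCentralSeries G (i + 1)) (q : G ⧸ upperCentralSeries G i) :
    Commute (e : G ⧸ upperCentralSeries G i) q := by
  obtain ⟨g, rfl⟩ := QuotientGroup.mk_surjective q
  rw [← commutatorElement_eq_one_iff_commute]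
  exact (QuotientGroup.eq_one_iff _).2 (mem_upperCentralSeries_succ_iff.1 he g)

theorem commutatorElement_mem_upperCentralSeries_right {i : ℕ} {h : G}
    (hh : h ∈ upperCentralSeries G (i + 1)) (g : G) :
    ⁅g, h⁆ ∈ upperCentralSeries G i := by
  rw [← commutatorElement_inv]
  exact inv_mem (mem_upperCentralSeries_succ_iff.1 hh g)

theorem commutatorElement_pow_mem_upperCentralSeries_iff {p : ℕ} (hodd : Odd p) {i : ℕ}
    (hpow : ∀ x ∈ upperCentralSeries G (i + 1), x ^ p ∈ upperCentralSeries G i)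
    {a h : G} (hah : ⁅a, h⁆ ∈ upperCentralSeries G (i + 2)) :
    ⁅a ^ p, h⁆ ∈ upperCentralSeries G i ↔
      ⁅a, h⁆ ^ p ∈ upperCentralSeries G i := by
  have he : ⁅⁅a, h⁆⁻¹, a⁆ ∈ upperCentralSeries G (i + 1) :=
    mem_upperCentralSeries_succ_iff.1 (inv_mem hah) a
  have h1 := commutatorElement_pow_left_s19 (G := G ⧸ upperCentralSeries G i) hodd
    (a := a) (h := h) (commute_mk_of_mem_upperCentralSeries_succ he)
    ((QuotientGroup.eq_one_iff _).2 (hpow _ he))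
  rw [← QuotientGroup.eq_one_iff, ← QuotientGroup.eq_one_iff]
  exact ⟨fun H => h1.symm.trans H, fun H => h1.trans H⟩

theorem mul_pow_mem_upperCentralSeries_iff {p : ℕ} (hodd : Odd p) {i : ℕ}
    (hpow : ∀ x ∈ upperCentralSeries G (i + 1), x ^ p ∈ upperCentralSeries G i)
    {x y : G} (hxy : ⁅y⁻¹, x⁻¹⁆ ∈ upperCentralSeries G (i + 1)) :
    (x * y) ^ p ∈ upperCentralSeries G i ↔
      x ^ p * y ^ p ∈ upperCentralSeries G i := by
  have h1 := mul_pow_eq_of_mul_eq_of_forall_commute (G := G ⧸ upperCentralSeries G i)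
    (x := x) (y := y) (e := (⁅y⁻¹, x⁻¹⁆ : G)) (commute_mk_of_mem_upperCentralSeries_succ hxy)
    (congrArg (QuotientGroup.mk (s := upperCentralSeries G i))
      (show y * x = x * y * ⁅y⁻¹, x⁻¹⁆ by simp only [commutatorElement_def]; group)) p
  rw [pow_choose_two_eq_one hodd ((QuotientGroup.eq_one_iff _).2 (hpow _ hxy)), mul_one] at h1
  rw [← QuotientGroup.eq_one_iff, ← QuotientGroup.eq_one_iff]
  exact ⟨fun H => h1.symm.trans H, fun H => h1.trans H⟩

end UpperCentral

theorem exists_mul_zpow_mem_of_card {G : Type*} [Group G] [Finite G] {p j : ℕ} (hp : p.Prime)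
    {H K : Subgroup G} [H.Normal] (hHK : H ≤ K) (hH : Nat.card H = p ^ j)
    (hK : Nat.card K = p ^ (j + 1)) {x w : G} (hx : x ∈ K) (hxH : x ∉ H) (hw : w ∈ K) :
    ∃ k : ℤ, w * x ^ k ∈ H := by
  have hle : H ⊔ zpowers x ≤ K := sup_le hHK (zpowers_le.2 hx)
  have heq : H ⊔ zpowers x = K := by
    obtain ⟨m, hm, hcard⟩ := (Nat.dvd_prime_pow hp).1 (hK ▸ card_dvd_of_le hle)
    have hjm : j ≤ m := (Nat.pow_dvd_pow_iff_le_right hp.one_lt).1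
      (hcard ▸ hH ▸ card_dvd_of_le (le_sup_left : H ≤ H ⊔ zpowers x))
    have hne : j ≠ m := by
      rintro rfl
      have := eq_of_le_of_card_ge (le_sup_left : H ≤ H ⊔ zpowers x) (by rw [hcard, hH])
      exact hxH (this ▸ (le_sup_right : zpowers x ≤ H ⊔ zpowers x) (mem_zpowers x))
    exact eq_of_le_of_card_ge hle (by rw [hcard, hK, show m = j + 1 by omega])
  rw [← heq, mem_sup_of_normal_left] at hw
  obtain ⟨y, hy, z, ⟨k, rfl⟩, rfl⟩ := hw
  exact ⟨-k, by simpa using hy⟩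

theorem pow_mem_of_card {G : Type*} [Group G] [Finite G] {p j : ℕ} (hp : p.Prime)
    {H K : Subgroup G} [H.Normal] (hHK : H ≤ K) (hH : Nat.card H = p ^ j)
    (hK : Nat.card K = p ^ (j + 1)) {x : G} (hx : x ∈ K) : x ^ p ∈ H := by
  have hidx : (H.subgroupOf K).index = p := by
    have := card_mul_index (H.subgroupOf K)
    rw [Nat.card_congr (subgroupOfEquivOfLe hHK).toEquiv, hH, hK, pow_succ] at this
    exact Nat.eq_of_mul_eq_mul_left (pow_pos hp.pos j) this
  have := pow_index_mem (H.subgroupOf K) ⟨x, hx⟩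
  rwa [hidx] at this

section MaximalClass

variable {G : Type*} [Group G] [Finite G] [Group.IsNilpotent G] {p c : ℕ}

theorem card_upperCentralSeries_of_maximal_class (hp : p.Prime)
    (hcard : Nat.card G = p ^ (c + 1)) (hclass : Group.nilpotencyClass G = c) {j : ℕ}
    (hj : j < c) : Nat.card (upperCentralSeries G j) = p ^ j := by
  have hex : ∀ j, ∃ m ≤ c + 1, Nat.card (upperCentralSeries G j) = p ^ m := fun j =>
    (Nat.dvd_prime_pow hp).1 (hcard ▸ card_subgroup_dvd_card _)
  choose e hec he using hex
  have hne : ∀ j < c, ¬ upperCentralSeries G (j + 1) ≤ upperCentralSeries G j := by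
    intro j hj hle
    have hstab : ∀ m, upperCentralSeries G (j + m) ≤ upperCentralSeries G j := by
      intro m
      induction m with
      | zero => exact le_rfl
      | succ m ih =>
        exact fun x hx => hle (mem_upperCentralSeries_succ_iff.2 fun y =>
          ih (mem_upperCentralSeries_succ_iff.1 hx y))
    have h1 := hstab (c - j)
    rw [Nat.add_sub_cancel' hj.le, ← hclass, upperCentralSeries_nilpotencyClass, top_le_iff,
      upperCentralSeries_eq_top_iff_nilpotencyClass_le] at h1
    omega
  have hlt : ∀ j < c, e j < e (j + 1) := by
    intro j hj
    by_contra! h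
    refine hne j hj (eq_of_le_of_card_ge (upperCentralSeries_mono G j.le_succ) ?_).ge
    rw [he, he]
    exact Nat.pow_le_pow_right hp.pos h
  have hlow : ∀ j ≤ c, j ≤ e j := by
    intro j
    induction j with
    | zero => simp
    | succ j ih => intro h; have := hlt j h; have := ih (by omega); omega
  have htop : ∀ m < c, e (c - 1 - m) ≤ c - 1 - m := by
    intro m
    induction m with
    | zero =>
      intro hc
      by_contra! h
      obtain ⟨d, rfl⟩ := Nat.exists_eq_add_of_lt hc
      simp only [zero_add, Nat.add_sub_cancel, Nat.sub_zero] at *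
      have h2 := hlt d (by omega)
      have h3 := hec (d + 1)
      have hed : e d = d + 1 := by omega
      have htp : upperCentralSeries G (d + 1) = ⊤ := by
        rw [← hclass, upperCentralSeries_nilpotencyClass]
      obtain ⟨x, -, hx⟩ := SetLike.not_le_iff_exists.1 (hne d (by omega))
      have hd0 : d ≠ 0 := by
        rintro rfl
        have := he 0
        rw [hed, upperCentralSeries_zero, card_bot, eq_comm, zero_add, pow_one] at this
        exact hp.one_lt.ne' this
      obtain ⟨b, rfl⟩ := Nat.exists_eq_succ_of_ne_zero hd0
      refine hx (mem_upperCentralSeries_succ_iff.2 fun w => ?_)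
      obtain ⟨k, hk⟩ := exists_mul_zpow_mem_of_card hp
        (upperCentralSeries_mono G (b + 1).le_succ) (he (b + 1))
        (K := upperCentralSeries G (b + 1 + 1)) (by rw [htp, card_top, hcard, hed])
        (htp ▸ mem_top x) hx (htp ▸ mem_top w)
      have hk' := commutatorElement_mem_upperCentralSeries_right hk x
      have : ⁅x, w * x ^ k⁆ = ⁅x, w⁆ := by
        simp only [commutatorElement_def, mul_inv_rev, mul_assoc]
        rw [← mul_assoc (x ^ k) x⁻¹, ← mul_assoc (x ^ k * x⁻¹),
          show x ^ k * x⁻¹ * (x ^ k)⁻¹ = x⁻¹ by group]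
      rwa [this] at hk'
    | succ m ih =>
      intro h
      have h1 := ih (by omega)
      have h2 := hlt (c - 1 - (m + 1)) (by omega)
      rw [show c - 1 - (m + 1) + 1 = c - 1 - m by omega] at h2
      omega
  have h1 := htop (c - 1 - j) (by omega)
  rw [show c - 1 - (c - 1 - j) = j by omega] at h1
  rw [he, le_antisymm h1 (hlow j hj.le)]

theorem pow_mem_upperCentralSeries_of_maximal_class (hp : p.Prime) (hodd : Odd p) (hc : 3 ≤ c)
    (hcard : Nat.card G = p ^ (c + 1)) (hclass : Group.nilpotencyClass G = c) (i : ℕ) {x : G}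
    (hx : x ∈ upperCentralSeries G (i + 2)) :
    x ^ p ∈ upperCentralSeries G i := by
  have hZ : ∀ j < c, Nat.card (upperCentralSeries G j) = p ^ j := fun j hj =>
    card_upperCentralSeries_of_maximal_class hp hcard hclass hj
  have hZtop : ∀ {j}, c ≤ j → upperCentralSeries G j = ⊤ := fun {j} hj =>
    upperCentralSeries_eq_top_iff_nilpotencyClass_le.2 (hclass ▸ hj)
  have hpow : ∀ j, j + 1 < c → ∀ x ∈ upperCentralSeries G (j + 1),
      x ^ p ∈ upperCentralSeries G j := fun j hj x hx =>
    pow_mem_of_card hp (upperCentralSeries_mono G j.le_succ) (hZ j (by omega)) (hZ _ hj) hx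
  have hgen : ∀ j, j + 1 < c → ∀ x ∈ upperCentralSeries G (j + 1),
      x ∉ upperCentralSeries G j → ∀ w ∈ upperCentralSeries G (j + 1),
      ∃ k : ℤ, w * x ^ k ∈ upperCentralSeries G j := fun j hj x hx hxj w hw =>
    exists_mul_zpow_mem_of_card hp (upperCentralSeries_mono G j.le_succ) (hZ j (by omega))
      (hZ _ hj) hx hxj hw
  have htop : ∀ a : G, a ^ p ∈ upperCentralSeries G (c - 2) := by
    obtain ⟨d, rfl⟩ := Nat.exists_eq_add_of_le' hc
    rw [show d + 3 - 2 = d + 1 by omega]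
    have hcomm : ∀ a h : G, ⁅a, h⁆ ∈ upperCentralSeries G (d + 2) := fun a h =>
      mem_upperCentralSeries_succ_iff.1 (hZtop le_rfl ▸ mem_top a) h
    have hpow2 : ∀ a : G, a ^ p ∈ upperCentralSeries G (d + 2) := fun a =>
      mem_upperCentralSeries_succ_iff.2 fun h =>
        (commutatorElement_pow_mem_upperCentralSeries_iff hodd (hpow (d + 1) (by omega))
          (upperCentralSeries_mono G (d + 2).le_succ (hcomm a h))).2
          (hpow (d + 1) (by omega) _ (hcomm a h))
    have hiff : ∀ a h : G, ⁅a ^ p, h⁆ ∈ upperCentralSeries G d ↔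
        ⁅a, h⁆ ^ p ∈ upperCentralSeries G d := fun a h =>
      commutatorElement_pow_mem_upperCentralSeries_iff hodd (hpow d (by omega)) (hcomm a h)
    have hcommpow : ∀ a h : G, ⁅a, h⁆ ^ p ∈ upperCentralSeries G d := by
      intro a h
      by_cases hh : h ^ p ∈ upperCentralSeries G (d + 1)
      · rw [← commutatorElement_inv, inv_pow, inv_mem_iff, ← hiff]
        exact mem_upperCentralSeries_succ_iff.1 hh a
      · obtain ⟨k, hk⟩ := hgen (d + 1) (by omega) _ (hpow2 h) hh _ (hpow2 a)
        have hg : (a * h ^ k) ^ p ∈ upperCentralSeries G (d + 1) := by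
          rw [mul_pow_mem_upperCentralSeries_iff hodd (hpow (d + 1) (by omega)) (hcomm _ _),
            ← zpow_natCast (h ^ k), zpow_comm, zpow_natCast]
          exact hk
        have hg' := (hiff (a * h ^ k) h).1 (mem_upperCentralSeries_succ_iff.1 hg h)
        have : ⁅a * h ^ k, h⁆ = ⁅a, h⁆ := by simp only [commutatorElement_def]; group
        rwa [this] at hg'
    exact fun a => mem_upperCentralSeries_succ_iff.2 fun h => (hiff a h).2 (hcommpow a h)
  have hdown : ∀ m, m + 2 ≤ c → ∀ x ∈ upperCentralSeries G (c - 2 - m + 2),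
      x ^ p ∈ upperCentralSeries G (c - 2 - m) := by
    intro m
    induction m with
    | zero => exact fun _ x _ => htop x
    | succ m ih =>
      intro hm x hx
      have ih := ih (by omega)
      rw [show c - 2 - m = c - 2 - (m + 1) + 1 by omega] at ih
      have hjc : c - 2 - (m + 1) + 3 ≤ c := by omega
      generalize c - 2 - (m + 1) = j at *
      obtain ⟨y, hy, hyj⟩ : ∃ y ∈ upperCentralSeries G (j + 3),
          y ∉ upperCentralSeries G (j + 2) := by
        by_contra! hle
        have hlt : p ^ (j + 2) < p ^ (j + 3) := Nat.pow_lt_pow_right hp.one_lt (by omega)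
        have hge := card_le_of_le (show upperCentralSeries G (j + 3) ≤ _ from hle)
        rw [hZ (j + 2) (by omega)] at hge
        rcases hjc.lt_or_eq with h | h
        · rw [hZ _ h] at hge; omega
        · rw [hZtop h.ge, card_top, hcard, ← h] at hge
          have := Nat.pow_le_pow_right hp.pos (show j + 3 ≤ j + 3 + 1 by omega)
          omega
      rw [mem_upperCentralSeries_succ_iff] at hyj
      push Not at hyj
      obtain ⟨g, hg⟩ := hyj
      have hz : ⁅y, g⁆ ∈ upperCentralSeries G (j + 2) :=
        mem_upperCentralSeries_succ_iff.1 hy g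
      have hzp : ⁅y, g⁆ ^ p ∈ upperCentralSeries G j :=
        (commutatorElement_pow_mem_upperCentralSeries_iff hodd (hpow j (by omega)) hz).1
          (mem_upperCentralSeries_succ_iff.1 (ih y hy) g)
      obtain ⟨k, hk⟩ := hgen (j + 1) (by omega) _ hz hg x hx
      have := (mul_pow_mem_upperCentralSeries_iff hodd (hpow j (by omega)) (x := x * ⁅y, g⁆ ^ k)
        (y := ⁅y, g⁆ ^ (-k)) (upperCentralSeries_mono G j.le_succ
          (commutatorElement_mem_upperCentralSeries_right (inv_mem hk) _))).2 (mul_mem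
          (hpow j (by omega) _ hk) (by
            rw [← zpow_natCast, zpow_comm, zpow_natCast]; exact zpow_mem hzp _))
      simpa using this
  by_cases hi : i + 2 ≤ c
  · have := hdown (c - 2 - i) (by omega) x
    rw [show c - 2 - (c - 2 - i) = i by omega] at this
    exact this hx
  · exact upperCentralSeries_mono G (show c - 2 ≤ i by omega) (htop x)

theorem le_upperCentralSeries_succ_of_maximal_class (hp : p.Prime) (hodd : Odd p) (hc : 3 ≤ c)
    (hcard : Nat.card G = p ^ (c + 1)) (hclass : Group.nilpotencyClass G = c) {i : ℕ}
    {N : Subgroup G} (hN : ⁅N, (⊤ : Subgroup G)⁆ ≤ pPow p N ⊔ upperCentralSeries G i) :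
    N ≤ upperCentralSeries G (i + 1) := by
  have hstep : ∀ j, i ≤ j → N ≤ upperCentralSeries G (j + 2) →
      N ≤ upperCentralSeries G (j + 1) := by
    intro j hj hle x hx
    refine mem_upperCentralSeries_succ_iff.2 fun g => ?_
    refine (sup_le ?_ (upperCentralSeries_mono G hj) : pPow p N ⊔ _ ≤ _)
      (hN (commutator_mem_commutator hx (mem_top g)))
    rw [pPow, closure_le]
    rintro _ ⟨y, hy, rfl⟩
    exact pow_mem_upperCentralSeries_of_maximal_class hp hodd hc hcard hclass j (hle hy)
  have hdesc : ∀ m, N ≤ upperCentralSeries G (i + m + 1) →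
      N ≤ upperCentralSeries G (i + 1) := by
    intro m
    induction m with
    | zero => exact id
    | succ m ih => exact fun h => ih (hstep (i + m) (by omega) h)
  refine hdesc c ?_
  rw [upperCentralSeries_eq_top_iff_nilpotencyClass_le.2 (by omega)]
  exact le_top

end MaximalClass

end Subgroup

/-- for a finite `p`-group of maximal class, `η_i(G) = Z_i(G)` for all `i`, and
its powerful class equals its nilpotency class `n - 1`. -/
theorem etaUp_eq_upperCentral_of_maximal_class {p : ℕ} (hp : p.Prime) (hodd : Odd p)
    {G : Type*} [Group G] [Finite G] [Group.IsNilpotent G]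
    {n : ℕ} (hn : 4 ≤ n) (hcard : Nat.card G = p ^ n)
    (hclass : Group.nilpotencyClass G = n - 1) :
    (∀ i, etaUp p G i = upperCentralSeries G i) ∧ pwc p G = n - 1 := by
  have hcard' : Nat.card G = p ^ (n - 1 + 1) := by rw [hcard, Nat.sub_add_cancel (by omega)]
  have heq : ∀ i, etaUp p G i = Subgroup.upperCentralSeries G i := by
    intro i
    induction i with
    | zero => rfl
    | succ i ih =>
      have hdef : etaUp p G (i + 1) = sSup {N : Subgroup G |
        N.Normal ∧ ⁅N, (⊤ : Subgroup G)⁆ ≤ pPow p N ⊔ etaUp p G i} := rfl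
      rw [hdef, ih]
      refine le_antisymm (sSup_le fun N hN =>
        Subgroup.le_upperCentralSeries_succ_of_maximal_class hp hodd (by omega) hcard' hclass hN.2)
        (le_sSup ⟨inferInstance, ?_⟩)
      exact (Subgroup.commutator_upperCentralSeries_top_le G i).trans le_sup_right
  refine ⟨heq, ?_⟩
  have hset : {k | etaUp p G k = ⊤} = Set.Ici (n - 1) := by
    ext k
    simp [heq, Subgroup.upperCentralSeries_eq_top_iff_nilpotencyClass_le, hclass]
  rw [pwc, hset, csInf_Ici]
end
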